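/- arXiv:1911.07304 — 6 statements merged into one kernel-verified Lean document; each statement's English description precedes it below -/
import Mathlib

section
/- A function h : 𝒳×𝒜 → ℝ is a stationary point of the limit ODE, i.e., Σ_{ζ'=(x',a')} π(ζ') A_{ζ,ζ'} ( r(ζ') + γ Σ_{z∈𝒳} max_{a''∈𝒜} h(z,a'') p(z|ζ') − h(ζ') ) = 0 for every ζ ∈ 𝒳×𝒜, if and only if h solves the Bellman equation. In particular, if the Bellman equation has a unique solution V, then V is the unique stationary point of the limit ODE. -/
open Matrix

/-- A positive definite matrix whose columns are rescaled by nonzero weights has trivial kernel. -/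
theorem Matrix.PosDef.weighted_sum_eq_zero_iff {ι : Type*} [Fintype ι]
    {A : Matrix ι ι ℝ} (hA : A.PosDef) {w : ι → ℝ} (hw : ∀ i, w i ≠ 0) (g : ι → ℝ) :
    (∀ i, ∑ j, w j * A i j * g j = 0) ↔ ∀ i, g i = 0 := by
  classical
  refine ⟨fun h i => ?_, fun h i => by simp [h]⟩
  have key : A *ᵥ (fun j => w j * g j) = 0 := by
    funext i
    rw [Pi.zero_apply, ← h i]
    exact Finset.sum_congr rfl fun j _ => by ring
  have hz := eq_zero_of_mulVec_eq_zero hA.det_pos.ne' key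
  exact (mul_eq_zero.mp (congrFun hz i)).resolve_left (hw i)

/-- A function `h` is a stationary point of the infinite-horizon limit ODE if and
only if `h` solves the Bellman equation; in particular, if the Bellman equation has
a unique solution `V`, then `V` is the unique stationary point of the limit ODE. -/
theorem stmt_2
    {𝒳 𝒜 : Type*} [Fintype 𝒳] [Fintype 𝒜] [Nonempty 𝒳] [Nonempty 𝒜]
    [DecidableEq 𝒳] [DecidableEq 𝒜]
    (r : 𝒳 × 𝒜 → ℝ)
    (p : 𝒳 → 𝒳 × 𝒜 → ℝ)
    (hp_nonneg : ∀ z ζ, 0 ≤ p z ζ)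
    (hp_sum : ∀ ζ, ∑ z : 𝒳, p z ζ = 1)
    (γ : ℝ) (hγ0 : 0 < γ) (hγ1 : γ ≤ 1)
    (π : 𝒳 × 𝒜 → ℝ) (hπ_pos : ∀ ζ, 0 < π ζ) (hπ_sum : ∑ ζ : 𝒳 × 𝒜, π ζ = 1)
    (A : Matrix (𝒳 × 𝒜) (𝒳 × 𝒜) ℝ) (hA : A.PosDef) :
    (∀ h : 𝒳 × 𝒜 → ℝ,
      (∀ ζ : 𝒳 × 𝒜, ∑ ζ' : 𝒳 × 𝒜, π ζ' * A ζ ζ' *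
          (r ζ' + γ * (∑ z : 𝒳, (⨆ a'' : 𝒜, h (z, a'')) * p z ζ') - h ζ') = 0)
        ↔ (∀ ζ : 𝒳 × 𝒜, h ζ = r ζ + γ * ∑ z : 𝒳, (⨆ a' : 𝒜, h (z, a')) * p z ζ))
    ∧ (∀ V : 𝒳 × 𝒜 → ℝ,
        ((∀ ζ : 𝒳 × 𝒜, V ζ = r ζ + γ * ∑ z : 𝒳, (⨆ a' : 𝒜, V (z, a')) * p z ζ) ∧
          (∀ V' : 𝒳 × 𝒜 → ℝ,
            (∀ ζ : 𝒳 × 𝒜, V' ζ = r ζ + γ * ∑ z : 𝒳, (⨆ a' : 𝒜, V' (z, a')) * p z ζ) → V' = V)) →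
        ((∀ ζ : 𝒳 × 𝒜, ∑ ζ' : 𝒳 × 𝒜, π ζ' * A ζ ζ' *
            (r ζ' + γ * (∑ z : 𝒳, (⨆ a'' : 𝒜, V (z, a'')) * p z ζ') - V ζ') = 0) ∧
          (∀ h : 𝒳 × 𝒜 → ℝ,
            (∀ ζ : 𝒳 × 𝒜, ∑ ζ' : 𝒳 × 𝒜, π ζ' * A ζ ζ' *
              (r ζ' + γ * (∑ z : 𝒳, (⨆ a'' : 𝒜, h (z, a'')) * p z ζ') - h ζ') = 0) → h = V))) := by
  have stationary_iff (h : 𝒳 × 𝒜 → ℝ) :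
      (∀ ζ : 𝒳 × 𝒜, ∑ ζ' : 𝒳 × 𝒜, π ζ' * A ζ ζ' *
          (r ζ' + γ * (∑ z : 𝒳, (⨆ a'' : 𝒜, h (z, a'')) * p z ζ') - h ζ') = 0)
        ↔ (∀ ζ : 𝒳 × 𝒜, h ζ = r ζ + γ * ∑ z : 𝒳, (⨆ a' : 𝒜, h (z, a')) * p z ζ) :=
    (hA.weighted_sum_eq_zero_iff (fun ζ => (hπ_pos ζ).ne') _).trans
      (forall_congr' fun _ => sub_eq_zero.trans eq_comm)
  exact ⟨stationary_iff, fun V hV =>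
    ⟨(stationary_iff V).mpr hV.1, fun h hh => hV.2 h ((stationary_iff h).mp hh)⟩⟩
end

section
/- Let 0 < α < ∞, M ≥ 1, and let x^(1), …, x^(M) ∈ ℝ^d be distinct data points such that the functions w ↦ σ(w·x^(i)), i = 1,…,M, are linearly independent as functions on ℝ^d. Define the M×M matrix A by A_{ij} = (α/M)⟨σ(w·x^(i)) σ(w·x^(j)), μ0⟩ + (α/M)⟨c² σ'(w·x^(j)) σ'(w·x^(i)) (x^(i)·x^(j)), μ0⟩, and let Ŷ ∈ ℝ^M. Then every solution h : [0,∞) → ℝ^M of the ODE dh_t/dt = A(Ŷ − h_t) (with arbitrary initial condition h_0 ∈ ℝ^M) satisfies h_t → Ŷ as t → ∞. In particular, the limiting neural network trained by stochastic gradient descent converges to a global minimum with zero training error. -/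
open MeasureTheory Matrix Filter
open scoped RealInnerProductSpace

/-- A matrix with positive quadratic form is coercive. -/
theorem exists_coercive_of_quadForm_pos {n : Type*} [Fintype n] (A : Matrix n n ℝ)
    (hA : ∀ v : n → ℝ, v ≠ 0 → 0 < v ⬝ᵥ A *ᵥ v) :
    ∃ c : ℝ, 0 < c ∧ ∀ v : n → ℝ, c * (v ⬝ᵥ v) ≤ v ⬝ᵥ A *ᵥ v := by
  have hsq : ∀ v : n → ℝ, v ≠ 0 → 0 < v ⬝ᵥ v := fun v hv =>
    lt_of_le_of_ne (Finset.sum_nonneg fun i _ => mul_self_nonneg (v i))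
      fun h0 => hv (dotProduct_self_eq_zero.1 h0.symm)
  have hne : ∀ v ∈ Metric.sphere (0 : n → ℝ) 1, v ≠ 0 := fun v hv =>
    ne_zero_of_mem_unit_sphere ⟨v, hv⟩
  rcases (Metric.sphere (0 : n → ℝ) 1).eq_empty_or_nonempty with hs | hs
  · refine ⟨1, one_pos, fun v => ?_⟩
    have hv : v = 0 := by
      by_contra hv
      have : ‖v‖⁻¹ • v ∈ Metric.sphere (0 : n → ℝ) 1 := by
        simp [norm_smul, norm_ne_zero_iff.2 hv]
      simp [hs] at this
    simp [hv]
  · have hcont : ContinuousOn (fun v : n → ℝ => (v ⬝ᵥ A *ᵥ v) / (v ⬝ᵥ v))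
        (Metric.sphere (0 : n → ℝ) 1) := by
      refine ContinuousOn.div (Continuous.continuousOn ?_) (Continuous.continuousOn ?_)
        fun v hv => (hsq v (hne v hv)).ne'
      · exact continuous_id.dotProduct (continuous_const.matrix_mulVec continuous_id)
      · exact continuous_id.dotProduct continuous_id
    obtain ⟨u, hu, hmin⟩ := (isCompact_sphere (0 : n → ℝ) 1).exists_isMinOn hs hcont
    refine ⟨_, div_pos (hA u (hne u hu)) (hsq u (hne u hu)), fun v => ?_⟩
    by_cases hv : v = 0
    · simp [hv]
    have hnv : ‖v‖ ≠ 0 := norm_ne_zero_iff.2 hv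
    have hmem : ‖v‖⁻¹ • v ∈ Metric.sphere (0 : n → ℝ) 1 := by
      simp [norm_smul, hnv]
    have hle := isMinOn_iff.1 hmin _ hmem
    simp only [mulVec_smul, dotProduct_smul, smul_dotProduct, smul_eq_mul] at hle
    rw [mul_div_mul_left _ _ (inv_ne_zero hnv), mul_div_mul_left _ _ (inv_ne_zero hnv)] at hle
    exact (le_div_iff₀ (hsq v hv)).1 hle

/-- A differentiable function with `f' ≤ -c f` and `c > 0`, `f ≥ 0` tends to zero. -/
theorem tendsto_zero_of_hasDerivAt_le_neg_mul {f f' : ℝ → ℝ} {c : ℝ} (hc : 0 < c)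
    (hf : ∀ t, 0 ≤ t → HasDerivAt f (f' t) t) (hf' : ∀ t, 0 ≤ t → f' t ≤ -(c * f t))
    (hf0 : ∀ t, 0 ≤ f t) : Tendsto f atTop (nhds 0) := by
  have hd : ∀ t, 0 ≤ t → HasDerivAt (fun s => Real.exp (c * s) * f s)
      (Real.exp (c * t) * c * f t + Real.exp (c * t) * f' t) t := fun t ht => by
    have h1 : HasDerivAt (fun s => Real.exp (c * s)) (Real.exp (c * t) * c) t := by
      simpa using ((hasDerivAt_id t).const_mul c).exp
    exact h1.mul (hf t ht)
  have hanti : AntitoneOn (fun s => Real.exp (c * s) * f s) (Set.Ici 0) := by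
    refine antitoneOn_of_deriv_nonpos (convex_Ici 0)
      (fun t ht => (hd t ht).continuousAt.continuousWithinAt)
      (fun t ht => ?_) fun t ht => ?_
    · exact (hd t (interior_subset ht)).differentiableAt.differentiableWithinAt
    · rw [(hd t (interior_subset ht)).deriv]
      have := mul_le_mul_of_nonneg_left (hf' t (interior_subset ht)) (Real.exp_pos (c * t)).le
      linarith
  have hlim : Tendsto (fun t : ℝ => Real.exp (-(c * t)) * f 0) atTop (nhds 0) := by
    have : Tendsto (fun t : ℝ => Real.exp (-(c * t))) atTop (nhds 0) :=
      Real.tendsto_exp_neg_atTop_nhds_zero.comp (tendsto_id.const_mul_atTop hc)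
    simpa using this.mul_const (f 0)
  refine squeeze_zero' (Eventually.of_forall hf0) ?_ hlim
  filter_upwards [eventually_ge_atTop 0] with t ht
  have h1 := hanti Set.self_mem_Ici ht ht
  simp only [mul_zero, Real.exp_zero, one_mul] at h1
  calc f t = Real.exp (-(c * t)) * (Real.exp (c * t) * f t) := by
        rw [← mul_assoc, ← Real.exp_add]; simp
    _ ≤ _ := mul_le_mul_of_nonneg_left h1 (Real.exp_pos _).le

/-- Solutions of `h' = A (Y - h)` converge to `Y` when the quadratic form of `A` is positive. -/
theorem tendsto_of_linear_ode_of_quadForm_pos {n : Type*} [Fintype n] (A : Matrix n n ℝ)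
    (hA : ∀ v : n → ℝ, v ≠ 0 → 0 < v ⬝ᵥ A *ᵥ v) (Y : n → ℝ) (h : ℝ → n → ℝ)
    (hODE : ∀ i, ∀ t : ℝ, 0 ≤ t → HasDerivAt (fun s => h s i) ((A *ᵥ (Y - h t)) i) t) :
    Tendsto h atTop (nhds Y) := by
  obtain ⟨c, hc, hcoer⟩ := exists_coercive_of_quadForm_pos A hA
  have hV : Tendsto (fun t => (Y - h t) ⬝ᵥ (Y - h t)) atTop (nhds 0) := by
    refine tendsto_zero_of_hasDerivAt_le_neg_mul (c := 2 * c)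
      (f' := fun t => -(2 * ((Y - h t) ⬝ᵥ A *ᵥ (Y - h t)))) (by positivity)
      (fun t ht => ?_) (fun t _ => ?_) fun t => Finset.sum_nonneg fun i _ => mul_self_nonneg _
    · have hi : ∀ i ∈ Finset.univ, HasDerivAt (fun s => (Y i - h s i) * (Y i - h s i))
          (-(A *ᵥ (Y - h t)) i * (Y i - h t i) + (Y i - h t i) * -(A *ᵥ (Y - h t)) i) t :=
        fun i _ => ((hODE i t ht).const_sub (Y i)).mul ((hODE i t ht).const_sub (Y i))
      refine (HasDerivAt.fun_sum hi).congr_deriv ?_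
      simp only [dotProduct, Finset.mul_sum, ← Finset.sum_neg_distrib]
      exact Finset.sum_congr rfl fun i _ => by simp only [Pi.sub_apply]; ring
    · have := hcoer (Y - h t)
      linarith
  rw [tendsto_pi_nhds]
  intro i
  have hsq : Tendsto (fun t => (Y i - h t i) ^ 2) atTop (nhds 0) := by
    refine squeeze_zero (fun t => sq_nonneg _) (fun t => ?_) hV
    rw [sq]
    exact Finset.single_le_sum (f := fun j => (Y - h t) j * (Y - h t) j)
      (fun j _ => mul_self_nonneg _) (Finset.mem_univ i)
  have habs : Tendsto (fun t => |Y i - h t i|) atTop (nhds 0) := by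
    simpa [Real.sqrt_sq_eq_abs] using hsq.sqrt
  simpa using ((tendsto_zero_iff_abs_tendsto_zero _).2 habs).const_sub (Y i)

/-- The quadratic form of a kernel matrix `∫ F i * F j` of square-integrable features. -/
theorem sum_mul_integral_inner_eq {Ω E n : Type*} [Fintype n] [MeasurableSpace Ω]
    [NormedAddCommGroup E] [InnerProductSpace ℝ E] (μ : Measure Ω) (F : n → Ω → E)
    (hF : ∀ i j, Integrable (fun p => ⟪F i p, F j p⟫) μ) (v : n → ℝ) :
    ∑ i, ∑ j, v i * v j * ∫ p, ⟪F i p, F j p⟫ ∂μ = ∫ p, ‖∑ i, v i • F i p‖ ^ 2 ∂μ := by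
  have hpt : ∀ p, ‖∑ i, v i • F i p‖ ^ 2 = ∑ i, ∑ j, v i * v j * ⟪F i p, F j p⟫ := fun p => by
    rw [← real_inner_self_eq_norm_sq, sum_inner]
    refine Finset.sum_congr rfl fun i _ => ?_
    rw [inner_sum]
    refine Finset.sum_congr rfl fun j _ => ?_
    rw [real_inner_smul_left, real_inner_smul_right]
    ring
  simp only [hpt]
  rw [integral_finsetSum _ fun i _ => integrable_finsetSum _ fun j _ => (hF i j).const_mul _]
  refine Finset.sum_congr rfl fun i _ => ?_
  rw [integral_finsetSum _ fun j _ => (hF i j).const_mul _]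
  exact Finset.sum_congr rfl fun j _ => (integral_const_mul _ _).symm

/-- A continuous nonzero function of the second variable has a positive second moment under a
measure charging every set of positive volume in the strip `[-B, B] × E`. -/
theorem integral_sq_snd_pos {E : Type*} [MeasureSpace E] [TopologicalSpace E]
    [OpensMeasurableSpace E] [SFinite (volume : Measure E)]
    [(volume : Measure E).IsOpenPosMeasure] (μ : Measure (ℝ × E)) {B : ℝ} (hB : 0 < B)
    (h_pos : ∀ Γ : Set (ℝ × E), MeasurableSet Γ →
      Γ ⊆ Set.Icc (-B) B ×ˢ Set.univ → 0 < volume Γ → 0 < μ Γ)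
    {g : E → ℝ} (hg : Continuous g) (hg0 : g ≠ 0) (hint : Integrable (fun p => g p.2 ^ 2) μ) :
    0 < ∫ p, g p.2 ^ 2 ∂μ := by
  rw [integral_pos_iff_support_of_nonneg (fun p => sq_nonneg _) hint]
  have hU : IsOpen (Function.support g) := hg.isOpen_support
  have hΓ : 0 < μ (Set.Icc (-B) B ×ˢ Function.support g) := by
    refine h_pos _ (measurableSet_Icc.prod hU.measurableSet)
      (Set.prod_mono le_rfl (Set.subset_univ _)) ?_
    rw [Measure.volume_eq_prod, Measure.prod_prod]
    refine ENNReal.mul_pos ?_ (hU.measure_pos volume (Function.support_nonempty_iff.2 hg0)).ne'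
    simpa using hB
  refine hΓ.trans_le (measure_mono fun p hp => ?_)
  exact pow_ne_zero 2 hp.2

/-- Theorem (zero training error): for the matrix `A` arising from the mean-field
limit of a single-layer neural network under the Xavier initialization, every
solution of the ODE `dh/dt = A(Ŷ − h)` converges to the data vector `Ŷ`, i.e. the
limiting network converges to a global minimum with zero training error. -/
theorem stmt_4
    {d M : ℕ} (hM : 1 ≤ M)
    (σ : ℝ → ℝ) (hσ : ContDiff ℝ 1 σ)
    (Cσ : ℝ) (hσ_bdd : ∀ y, |σ y| ≤ Cσ) (hσ'_bdd : ∀ y, |deriv σ y| ≤ Cσ)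
    (μ0 : Measure (ℝ × EuclideanSpace ℝ (Fin d))) [IsProbabilityMeasure μ0]
    (B : ℝ) (hB : 0 < B)
    (hC_bdd : ∀ᵐ p ∂μ0, |p.1| ≤ B)
    (hC_mean : ∫ p, p.1 ∂μ0 = 0)
    (h_indep : μ0 = (μ0.map Prod.fst).prod (μ0.map Prod.snd))
    (h_pos : ∀ Γ : Set (ℝ × EuclideanSpace ℝ (Fin d)), MeasurableSet Γ →
      Γ ⊆ Set.Icc (-B) B ×ˢ Set.univ → 0 < volume Γ → 0 < μ0 Γ)
    (α : ℝ) (hα : 0 < α)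
    (x : Fin M → EuclideanSpace ℝ (Fin d))
    (hx_distinct : Function.Injective x)
    (h_lin_indep :
      LinearIndependent ℝ (fun i : Fin M =>
        (fun w : EuclideanSpace ℝ (Fin d) => σ ⟪w, x i⟫)))
    (A : Matrix (Fin M) (Fin M) ℝ)
    (hA : ∀ i j, A i j =
      (α / M) * ∫ p, σ ⟪p.2, x i⟫ * σ ⟪p.2, x j⟫ ∂μ0 +
      (α / M) * ∫ p, p.1 ^ 2 * deriv σ ⟪p.2, x j⟫ * deriv σ ⟪p.2, x i⟫ * ⟪x i, x j⟫ ∂μ0)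
    (Y : Fin M → ℝ)
    (h : ℝ → Fin M → ℝ)
    (hODE : ∀ i : Fin M, ∀ t : ℝ, 0 ≤ t →
      HasDerivAt (fun s => h s i) ((A *ᵥ (Y - h t)) i) t) :
    Tendsto h atTop (nhds Y) := by
  refine tendsto_of_linear_ode_of_quadForm_pos A (fun v hv => ?_) Y h hODE
  have hσ' : Continuous (deriv σ) := hσ.continuous_deriv le_rfl
  have hσc : Continuous σ := hσ.continuous
  have hF : ∀ i j, Integrable (fun p : ℝ × EuclideanSpace ℝ (Fin d) =>
      ⟪σ ⟪p.2, x i⟫, σ ⟪p.2, x j⟫⟫) μ0 := fun i j => by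
    refine Integrable.of_bound (C := Cσ * Cσ)
      (Continuous.aestronglyMeasurable (by fun_prop)) (ae_of_all _ fun p => ?_)
    refine (norm_inner_le_norm _ _).trans ?_
    exact mul_le_mul (hσ_bdd _) (hσ_bdd _) (norm_nonneg _) ((abs_nonneg _).trans (hσ_bdd 0))
  have hG : ∀ i j, Integrable (fun p : ℝ × EuclideanSpace ℝ (Fin d) =>
      ⟪(p.1 * deriv σ ⟪p.2, x i⟫) • x i, (p.1 * deriv σ ⟪p.2, x j⟫) • x j⟫) μ0 := fun i j => by
    refine Integrable.of_bound (C := B * Cσ * ‖x i‖ * (B * Cσ * ‖x j‖))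
      (Continuous.aestronglyMeasurable (by fun_prop)) ?_
    filter_upwards [hC_bdd] with p hp
    have hk : ∀ k, ‖(p.1 * deriv σ ⟪p.2, x k⟫) • x k‖ ≤ B * Cσ * ‖x k‖ := fun k => by
      rw [norm_smul, norm_mul]
      exact mul_le_mul_of_nonneg_right
        (mul_le_mul hp (hσ'_bdd _) (norm_nonneg _) hB.le) (norm_nonneg _)
    exact (norm_inner_le_norm _ _).trans
      (mul_le_mul (hk i) (hk j) (norm_nonneg _) ((norm_nonneg _).trans (hk i)))
  have hquad : v ⬝ᵥ A *ᵥ v = α / M *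
      (∫ p, ‖∑ i, v i • σ ⟪p.2, x i⟫‖ ^ 2 ∂μ0 +
        ∫ p, ‖∑ i, v i • (p.1 * deriv σ ⟪p.2, x i⟫) • x i‖ ^ 2 ∂μ0) := by
    rw [← sum_mul_integral_inner_eq μ0 _ hF v, ← sum_mul_integral_inner_eq μ0 _ hG v,
      ← Finset.sum_add_distrib, Finset.mul_sum]
    refine Finset.sum_congr rfl fun i _ => ?_
    rw [← Finset.sum_add_distrib, Finset.mul_sum, mulVec, dotProduct, Finset.mul_sum]
    refine Finset.sum_congr rfl fun j _ => ?_
    have h1 : ∀ p : ℝ × EuclideanSpace ℝ (Fin d),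
        ⟪σ ⟪p.2, x i⟫, σ ⟪p.2, x j⟫⟫ = σ ⟪p.2, x i⟫ * σ ⟪p.2, x j⟫ := fun p => by
      simp [mul_comm]
    have h2 : ∀ p : ℝ × EuclideanSpace ℝ (Fin d),
        ⟪(p.1 * deriv σ ⟪p.2, x i⟫) • x i, (p.1 * deriv σ ⟪p.2, x j⟫) • x j⟫ =
          p.1 ^ 2 * deriv σ ⟪p.2, x j⟫ * deriv σ ⟪p.2, x i⟫ * ⟪x i, x j⟫ := fun p => by
      rw [real_inner_smul_left, real_inner_smul_right]
      ring
    simp only [hA i j, h1, h2]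
    ring
  have hM' : (0 : ℝ) < M := by exact_mod_cast hM
  rw [hquad]
  refine mul_pos (div_pos hα hM')
    (add_pos_of_pos_of_nonneg ?_ (integral_nonneg fun p => sq_nonneg _))
  simp only [Real.norm_eq_abs, sq_abs]
  have hgc : Continuous fun w : EuclideanSpace ℝ (Fin d) => ∑ i, v i • σ ⟪w, x i⟫ := by fun_prop
  refine integral_sq_snd_pos μ0 hB h_pos hgc (fun h0 => hv ?_) ?_
  · funext i
    refine Fintype.linearIndependent_iff.1 h_lin_indep v ?_ i
    rw [← h0]
    ext w
    simp
  · refine Integrable.of_bound (C := (∑ i, |v i| * Cσ) ^ 2)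
      (Continuous.aestronglyMeasurable (by fun_prop)) (ae_of_all _ fun p => ?_)
    rw [norm_pow]
    refine pow_le_pow_left₀ (norm_nonneg _) ((norm_sum_le _ _).trans ?_) 2
    refine Finset.sum_le_sum fun i _ => ?_
    rw [norm_smul]
    exact mul_le_mul_of_nonneg_left (hσ_bdd _) (norm_nonneg _)
end

section
/- For each N ∈ ℕ let f^N : S → ℝ be a random function (on the same probability space as (z_k)) such that sup_N max_{s∈S} E[(f^N(s))²] < ∞. Then lim_{N→∞} E[ | (1/N) Σ_{k=0}^{N−1} f^N(z_k) − Σ_{s∈S} f^N(s) q(s) | ] = 0. -/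
open MeasureTheory Filter

/-- Bounded convergence: a uniformly bounded sequence tending to zero in measure tends to zero in
mean square. -/
theorem tendsto_integral_sq_zero_of_tendstoInMeasure_of_bounded
    {Ω : Type*} [MeasurableSpace Ω] (P : Measure Ω) [IsProbabilityMeasure P]
    {X : ℕ → Ω → ℝ} (hX : ∀ n, Measurable (X n)) {K : ℝ} (hK : ∀ n ω, |X n ω| ≤ K)
    (h : TendstoInMeasure P X atTop (fun _ => 0)) :
    Tendsto (fun n => ∫ ω, X n ω ^ 2 ∂P) atTop (nhds 0) := by
  rw [Metric.tendsto_atTop]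
  intro η hη
  have hε : 0 < √(η / 2) := by positivity
  have hlim := ((tendstoInMeasure_iff_measureReal_norm.1 h) _ hε).const_mul (K ^ 2)
  rw [mul_zero] at hlim
  obtain ⟨n₀, hn₀⟩ := eventually_atTop.1 (hlim.eventually_lt_const (half_pos hη))
  refine ⟨n₀, fun n hn => ?_⟩
  set A : Set Ω := {ω | √(η / 2) ≤ ‖X n ω - 0‖} with hA_def
  have hA : MeasurableSet A := measurableSet_le measurable_const ((hX n).sub_const 0).norm
  have hpt : ∀ ω, X n ω ^ 2 ≤ η / 2 + A.indicator (fun _ => K ^ 2) ω := by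
    intro ω
    by_cases hω : ω ∈ A
    · rw [Set.indicator_of_mem hω]
      have := sq_le_sq' (by linarith [neg_abs_le (X n ω), hK n ω])
        ((le_abs_self _).trans (hK n ω))
      linarith
    · rw [Set.indicator_of_notMem hω, add_zero]
      have hlt : |X n ω| < √(η / 2) := by simpa [hA_def] using hω
      rw [← sq_abs, ← Real.sq_sqrt (half_pos hη).le]
      gcongr
  have hind : Integrable (A.indicator (fun _ : Ω => K ^ 2)) P :=
    (integrable_const _).indicator hA
  have hle : ∫ ω, X n ω ^ 2 ∂P ≤ η / 2 + K ^ 2 * P.real A := by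
    calc ∫ ω, X n ω ^ 2 ∂P ≤ ∫ ω, (η / 2 + A.indicator (fun _ => K ^ 2) ω) ∂P :=
          integral_mono_of_nonneg (.of_forall fun ω => sq_nonneg _)
            ((integrable_const _).add hind) (.of_forall hpt)
      _ = η / 2 + K ^ 2 * P.real A := by
          rw [integral_add (integrable_const _) hind, integral_indicator_const _ hA]
          simp [mul_comm]
  rw [Real.dist_eq, sub_zero, abs_of_nonneg (integral_nonneg fun ω => sq_nonneg _)]
  linarith [hn₀ n hn]

/-- The product of an `L²`-bounded sequence and a sequence tending to zero in `L²` tends to zero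
in `L¹`. -/
theorem tendsto_integral_abs_mul_zero_of_integral_sq
    {Ω : Type*} [MeasurableSpace Ω] (P : Measure Ω)
    {X Y : ℕ → Ω → ℝ} (hX : ∀ n, MemLp (X n) 2 P) (hY : ∀ n, MemLp (Y n) 2 P) {C : ℝ}
    (hC : ∀ n, ∫ ω, X n ω ^ 2 ∂P ≤ C)
    (hlim : Tendsto (fun n => ∫ ω, Y n ω ^ 2 ∂P) atTop (nhds 0)) :
    Tendsto (fun n => ∫ ω, |X n ω * Y n ω| ∂P) atTop (nhds 0) := by
  have hsqrt : Tendsto (fun n => √C * √(∫ ω, Y n ω ^ 2 ∂P)) atTop (nhds 0) := by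
    simpa using hlim.sqrt.const_mul (√C)
  refine squeeze_zero (fun n => integral_nonneg fun ω => abs_nonneg _) (fun n => ?_) hsqrt
  have hH := integral_mul_norm_le_Lp_mul_Lq (μ := P) (f := X n) (g := Y n)
    Real.HolderConjugate.two_two (by simpa using hX n) (by simpa using hY n)
  simp only [Real.norm_eq_abs, Real.rpow_two, sq_abs, ← Real.sqrt_eq_rpow, ← abs_mul] at hH
  exact hH.trans (by gcongr; exact hC n)

/-- Lemma 5 (ergodic averaging of random functions): if the empirical frequencies of
the process `(z_k)` converge in probability to `q`, and `f^N : S → ℝ` are random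
functions uniformly bounded in `L²`, then
`E | (1/N) Σ_{k<N} f^N(z_k) − Σ_s f^N(s) q(s) | → 0`. -/
theorem stmt_5
    {Ω : Type*} [MeasurableSpace Ω] (P : Measure Ω) [IsProbabilityMeasure P]
    {S : Type*} [Fintype S] [Nonempty S] [MeasurableSpace S] [MeasurableSingletonClass S] [DecidableEq S]
    (q : S → ℝ) (hq_nonneg : ∀ s, 0 ≤ q s) (hq_sum : ∑ s : S, q s = 1)
    (z : ℕ → Ω → S) (hz_meas : ∀ k, Measurable (z k))
    (hz_freq : ∀ s : S,
      TendstoInMeasure P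
        (fun (N : ℕ) (ω : Ω) => (N : ℝ)⁻¹ * ∑ k ∈ Finset.range N, (if z k ω = s then (1 : ℝ) else 0))
        atTop (fun _ => q s))
    (f : ℕ → Ω → S → ℝ)
    (hf_meas : ∀ N s, Measurable (fun ω => f N ω s))
    (hf_int : ∀ N s, Integrable (fun ω => (f N ω s) ^ 2) P)
    (C : ℝ)
    (hf_L2 : ∀ N s, ∫ ω, (f N ω s) ^ 2 ∂P ≤ C) :
    Tendsto
      (fun N : ℕ =>
        ∫ ω, |(N : ℝ)⁻¹ * (∑ k ∈ Finset.range N, f N ω (z k ω)) - ∑ s : S, f N ω s * q s| ∂P)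
      atTop (nhds 0) := by
  set freq : S → ℕ → Ω → ℝ := fun s N ω =>
    (N : ℝ)⁻¹ * ∑ k ∈ Finset.range N, (if z k ω = s then (1 : ℝ) else 0) with hfreq
  have hq_le : ∀ s, q s ≤ 1 := fun s =>
    hq_sum ▸ Finset.single_le_sum (fun t _ => hq_nonneg t) (Finset.mem_univ s)
  have hfreq_nonneg : ∀ s N ω, 0 ≤ freq s N ω := fun s N ω =>
    mul_nonneg (by positivity) (Finset.sum_nonneg fun k _ => by split_ifs <;> norm_num)
  have hfreq_le : ∀ s N ω, freq s N ω ≤ 1 := by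
    intro s N ω
    have hsum : ∑ k ∈ Finset.range N, (if z k ω = s then (1 : ℝ) else 0) ≤ N := by
      simpa using Finset.sum_le_card_nsmul (Finset.range N)
        (fun k => if z k ω = s then (1 : ℝ) else 0) 1 (fun k _ => by split_ifs <;> norm_num)
    calc freq s N ω ≤ (N : ℝ)⁻¹ * N := by simp only [hfreq]; gcongr
      _ ≤ 1 := inv_mul_le_one
  have hfreq_meas : ∀ s N, Measurable (freq s N) := fun s N =>
    (Finset.measurable_fun_sum _ fun k _ =>
      Measurable.ite (hz_meas k (measurableSet_singleton s)) measurable_const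
        measurable_const).const_mul _
  have hdev_meas : ∀ s N, Measurable (fun ω => freq s N ω - q s) := fun s N =>
    (hfreq_meas s N).sub_const _
  have hdev_le : ∀ s N ω, |freq s N ω - q s| ≤ 1 := fun s N ω =>
    abs_le.2 ⟨by linarith [hfreq_nonneg s N ω, hq_le s],
      by linarith [hfreq_le s N ω, hq_nonneg s]⟩
  have hf_memLp : ∀ s N, MemLp (fun ω => f N ω s) 2 P := fun s N =>
    (memLp_two_iff_integrable_sq (hf_meas N s).aestronglyMeasurable).2 (hf_int N s)
  have hdev_memLp : ∀ s N, MemLp (fun ω => freq s N ω - q s) 2 P := fun s N =>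
    MemLp.of_bound (hdev_meas s N).aestronglyMeasurable 1 (.of_forall (hdev_le s N))
  have hterm : ∀ s, Tendsto (fun N => ∫ ω, |f N ω s * (freq s N ω - q s)| ∂P) atTop (nhds 0) := by
    intro s
    refine tendsto_integral_abs_mul_zero_of_integral_sq P (hf_memLp s) (hdev_memLp s)
      (fun N => hf_L2 N s)
      (tendsto_integral_sq_zero_of_tendstoInMeasure_of_bounded P (hdev_meas s) (hdev_le s) ?_)
    rw [tendstoInMeasure_iff_norm]
    simpa only [sub_zero] using tendstoInMeasure_iff_norm.1 (hz_freq s)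
  have hint : ∀ s N, Integrable (fun ω => |f N ω s * (freq s N ω - q s)|) P := fun s N =>
    ((hf_memLp s N).integrable_mul (hdev_memLp s N)).abs
  have hdecomp : ∀ (N : ℕ) (ω : Ω),
      (N : ℝ)⁻¹ * (∑ k ∈ Finset.range N, f N ω (z k ω)) - ∑ s, f N ω s * q s
      = ∑ s, f N ω s * (freq s N ω - q s) := by
    intro N ω
    have hsplit : ∑ k ∈ Finset.range N, f N ω (z k ω)
        = ∑ s, f N ω s * ∑ k ∈ Finset.range N, (if z k ω = s then (1 : ℝ) else 0) := by
      simp_rw [Finset.mul_sum]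
      rw [Finset.sum_comm]
      simp
    simp_rw [mul_sub, Finset.sum_sub_distrib]
    rw [hsplit, Finset.mul_sum]
    exact congrArg (· - _) (Finset.sum_congr rfl fun s _ => mul_left_comm _ _ _)
  have hsum := tendsto_finsetSum Finset.univ fun s _ => hterm s
  rw [Finset.sum_const_zero] at hsum
  refine squeeze_zero (fun N => integral_nonneg fun ω => abs_nonneg _) (fun N => ?_) hsum
  rw [← integral_finsetSum _ fun s _ => hint s N]
  refine integral_mono_of_nonneg (.of_forall fun ω => abs_nonneg _)
    (integrable_finsetSum _ fun s _ => hint s N) (.of_forall fun ω => ?_)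
  simp only [hdecomp]
  exact Finset.abs_sum_le_sum_abs _ _
end

section
/- Fix T > 0 and a constant C < ∞. For each N ∈ ℕ and each 0 ≤ k ≤ ⌊NT⌋ let f_k^N : S → ℝ be a random function such that max_{s∈S} E[ |f_k^N(s) − f_{k−1}^N(s)| ] ≤ C/N for all 1 ≤ k ≤ ⌊NT⌋, and sup_{0≤k≤⌊NT⌋} max_{s∈S} E[ |f_k^N(s)|² ] ≤ C. Define, for t ∈ (0,T], M_t^N = (1/N) Σ_{k=0}^{⌊Nt⌋−1} ( f_k^N(z_k) − Σ_{s∈S} f_k^N(s) q(s) ). Then lim_{N→∞} sup_{t∈(0,T]} E[ |M_t^N| ] = 0. -/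
open MeasureTheory Filter

section ErgodicAveraging

variable {Ω : Type*} [MeasurableSpace Ω] {P : Measure Ω}

/-- Bounded convergence in measure implies convergence of second moments. -/
theorem tendsto_integral_sq_of_tendstoInMeasure_zero [IsProbabilityMeasure P] {X : ℕ → Ω → ℝ}
    (hX : ∀ n, Measurable (X n)) (hbdd : ∀ n ω, |X n ω| ≤ 1)
    (hlim : TendstoInMeasure P X atTop (fun _ => 0)) :
    Tendsto (fun n => ∫ ω, X n ω ^ 2 ∂P) atTop (nhds 0) := by
  refine tendsto_of_subseq_tendsto fun ns hns => ?_
  obtain ⟨ms, -, hms⟩ :=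
    TendstoInMeasure.exists_seq_tendsto_ae fun ε hε => (hlim ε hε).comp hns
  refine ⟨ms, ?_⟩
  have h := tendsto_integral_of_dominated_convergence (μ := P)
    (F := fun n ω => X (ns (ms n)) ω ^ 2) (f := fun _ => 0) (fun _ => (1 : ℝ))
    (fun n => ((hX _).pow_const 2).aestronglyMeasurable) (integrable_const _)
    (fun n => ae_of_all _ fun ω => by
      rw [norm_pow, Real.norm_eq_abs]
      exact pow_le_one₀ (abs_nonneg _) (hbdd _ ω))
    (by
      filter_upwards [hms] with ω hω
      simpa using hω.pow 2)
  simpa using h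

theorem abs_sum_range_le {g : ℕ → ℝ} (hg : ∀ k, |g k| ≤ 1) (a : ℕ) :
    |∑ k ∈ Finset.range a, g k| ≤ a :=
  (Finset.abs_sum_le_sum_abs _ _).trans
    ((Finset.sum_le_sum fun k _ => hg k).trans (by simp))

/-- If the averages of a bounded sequence tend to zero in probability, then the second moments of
its partial sums are `o(a²)`, with explicit constants. -/
theorem exists_integral_sq_sum_range_le [IsProbabilityMeasure P] {g : ℕ → Ω → ℝ} (hg : ∀ k, Measurable (g k))
    (hbdd : ∀ k ω, |g k ω| ≤ 1)
    (hlim : TendstoInMeasure P (fun (N : ℕ) ω => (N : ℝ)⁻¹ * ∑ k ∈ Finset.range N, g k ω)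
      atTop (fun _ => 0)) {ε : ℝ} (hε : 0 < ε) :
    ∃ K : ℝ, 0 ≤ K ∧ ∀ a : ℕ,
      ∫ ω, (∑ k ∈ Finset.range a, g k ω) ^ 2 ∂P ≤ ε * (a : ℝ) ^ 2 + K := by
  have hconv := tendsto_integral_sq_of_tendstoInMeasure_zero
    (fun N => (Finset.measurable_sum _ fun k _ => hg k).const_mul _)
    (fun N ω => by
      rw [abs_mul, abs_inv, Nat.abs_cast, inv_mul_eq_div]
      exact div_le_one_of_le₀ (abs_sum_range_le (fun k => hbdd k ω) N) N.cast_nonneg) hlim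
  obtain ⟨N₀, hN₀⟩ := eventually_atTop.1 (hconv.eventually_lt_const hε)
  refine ⟨(N₀ : ℝ) ^ 2, by positivity, fun a => ?_⟩
  rcases Nat.eq_zero_or_pos a with rfl | ha
  · simp
  have ha' : (0 : ℝ) < a := by exact_mod_cast ha
  rcases le_total N₀ a with h | h
  · have h1 := (hN₀ a h).le
    simp_rw [mul_pow] at h1
    rw [integral_const_mul, inv_pow, inv_mul_le_iff₀ (by positivity)] at h1
    nlinarith [sq_nonneg (N₀ : ℝ)]
  · have h2 : ∫ ω, (∑ k ∈ Finset.range a, g k ω) ^ 2 ∂P ≤ ∫ _ω, (a : ℝ) ^ 2 ∂P := by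
      refine integral_mono_of_nonneg (ae_of_all _ fun ω => sq_nonneg _) (integrable_const _)
        (ae_of_all _ fun ω => ?_)
      exact sq_le_sq' (abs_le.1 (abs_sum_range_le (fun k => hbdd k ω) a)).1
        (abs_le.1 (abs_sum_range_le (fun k => hbdd k ω) a)).2
    have h3 : (a : ℝ) ^ 2 ≤ (N₀ : ℝ) ^ 2 := by gcongr
    simp only [integral_const, probReal_univ, one_smul] at h2
    have : 0 ≤ ε * (a : ℝ) ^ 2 := by positivity
    linarith

/-- Summation over consecutive blocks of length `L` of a weight that is constant on each block. -/
theorem sum_range_div_mul {L : ℕ} (hL : 0 < L) (F g : ℕ → ℝ) (n : ℕ) :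
    ∀ m ≤ n * L, ∑ k ∈ Finset.range m, F (k / L) * g k =
      ∑ j ∈ Finset.range n, F j * (∑ k ∈ Finset.range (min ((j + 1) * L) m), g k -
        ∑ k ∈ Finset.range (min (j * L) m), g k) := by
  induction n with
  | zero => intro m hm; simp_all
  | succ n ih =>
    intro m hm
    rw [Finset.sum_range_succ]
    rcases le_total m (n * L) with h | h
    · rw [ih m h, min_eq_right h, min_eq_right (by lia)]
      simp
    · have h1 : ∀ j ∈ Finset.range n, min ((j + 1) * L) m = min ((j + 1) * L) (n * L) ∧
          min (j * L) m = min (j * L) (n * L) := by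
        intro j hj
        have hj' : (j + 1) * L ≤ n * L := Nat.mul_le_mul_right _ (Finset.mem_range.1 hj)
        have hj'' : j * L ≤ (j + 1) * L := Nat.mul_le_mul_right _ j.le_succ
        omega
      have h2 : ∑ k ∈ Finset.Ico (n * L) m, F (k / L) * g k =
          F n * ∑ k ∈ Finset.Ico (n * L) m, g k := by
        rw [Finset.mul_sum]
        refine Finset.sum_congr rfl fun k hk => ?_
        rw [Finset.mem_Ico] at hk
        rw [Nat.div_eq_of_lt_le hk.1 (hk.2.trans_le hm)]
      have h3 : ∑ j ∈ Finset.range n, F j * (∑ k ∈ Finset.range (min ((j + 1) * L) m), g k -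
          ∑ k ∈ Finset.range (min (j * L) m), g k) =
          ∑ k ∈ Finset.range (n * L), F (k / L) * g k := by
        rw [ih _ le_rfl]
        exact Finset.sum_congr rfl fun j hj => by rw [(h1 j hj).1, (h1 j hj).2]
      rw [h3, min_eq_left h, min_eq_right hm, ← Finset.sum_Ico_eq_sub _ h, ← h2,
        Finset.sum_range_add_sum_Ico _ h]

theorem integrable_of_integrable_sq [IsProbabilityMeasure P] {X : Ω → ℝ} (hX : Measurable X)
    (hX2 : Integrable (fun ω => X ω ^ 2) P) : Integrable X P :=
  ((memLp_two_iff_integrable_sq hX.aestronglyMeasurable).2 hX2).integrable (by norm_num)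

theorem integral_abs_sub_le_mul {φ : ℕ → Ω → ℝ} (hφ : ∀ k, Integrable (φ k) P) {M : ℕ} {c : ℝ}
    (hlip : ∀ k, 1 ≤ k → k ≤ M → ∫ ω, |φ k ω - φ (k - 1) ω| ∂P ≤ c) (b d : ℕ)
    (hbd : b + d ≤ M) : ∫ ω, |φ (b + d) ω - φ b ω| ∂P ≤ d * c := by
  induction d with
  | zero => simp
  | succ d ih =>
    have h1 := ih (by omega)
    have h2 := hlip (b + (d + 1)) (by omega) hbd
    rw [show b + (d + 1) - 1 = b + d by omega] at h2
    calc ∫ ω, |φ (b + (d + 1)) ω - φ b ω| ∂P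
        ≤ ∫ ω, (|φ (b + (d + 1)) ω - φ (b + d) ω| + |φ (b + d) ω - φ b ω|) ∂P :=
          integral_mono ((hφ _).sub (hφ _)).abs (((hφ _).sub (hφ _)).abs.add
            ((hφ _).sub (hφ _)).abs) fun ω => abs_sub_le _ _ _
      _ = ∫ ω, |φ (b + (d + 1)) ω - φ (b + d) ω| ∂P + ∫ ω, |φ (b + d) ω - φ b ω| ∂P :=
          integral_add ((hφ _).sub (hφ _)).abs ((hφ _).sub (hφ _)).abs
      _ ≤ ((d + 1 : ℕ) : ℝ) * c := by push_cast; linarith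

theorem mul_abs_sub_le {η : ℝ} (hη : 0 < η) (x y w : ℝ) :
    |x * (y - w)| ≤ η * x ^ 2 + η⁻¹ * (2 * y ^ 2 + 2 * w ^ 2) := by
  have h1 : |x * (y - w)| ≤ η * x ^ 2 + η⁻¹ * (y - w) ^ 2 := by
    have h : η⁻¹ * (y - w) ^ 2 = η * (η⁻¹ * (y - w)) ^ 2 := by field_simp
    have h' : x * (y - w) = η * (x * (η⁻¹ * (y - w))) := by field_simp
    rw [h, h', abs_mul, abs_of_pos hη, ← mul_add]
    refine mul_le_mul_of_nonneg_left ?_ hη.le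
    rw [abs_le]
    constructor <;> nlinarith [sq_nonneg (x + η⁻¹ * (y - w)), sq_nonneg (x - η⁻¹ * (y - w)),
      sq_nonneg x, sq_nonneg (η⁻¹ * (y - w))]
  have h2 : (y - w) ^ 2 ≤ 2 * y ^ 2 + 2 * w ^ 2 := by nlinarith [sq_nonneg (y + w)]
  exact h1.trans (by gcongr)

/-- Block estimate: freezing the weights on blocks of length `L` costs `L * c` per term, and
each block contributes through the second moments of the partial sums of `g`. -/
theorem integral_abs_sum_mul_le [IsProbabilityMeasure P] {φ g : ℕ → Ω → ℝ} (hφ : ∀ k, Measurable (φ k))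
    (hφ2 : ∀ k, Integrable (fun ω => φ k ω ^ 2) P) (hg : ∀ k, Measurable (g k))
    (hbdd : ∀ k ω, |g k ω| ≤ 1) {M : ℕ} {c C : ℝ} (hc : 0 ≤ c)
    (hlip : ∀ k, 1 ≤ k → k ≤ M → ∫ ω, |φ k ω - φ (k - 1) ω| ∂P ≤ c)
    (hL2 : ∀ k ≤ M, ∫ ω, φ k ω ^ 2 ∂P ≤ C) {m : ℕ} (hm : m ≤ M) {L : ℕ} (hL : 0 < L)
    {η B : ℝ} (hη : 0 < η)
    (hB : ∀ a ≤ m, ∫ ω, (∑ k ∈ Finset.range a, g k ω) ^ 2 ∂P ≤ B) :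
    ∫ ω, |∑ k ∈ Finset.range m, φ k ω * g k ω| ∂P ≤
      m * (L * c) + ((m / L : ℕ) + 1) * (η * C + η⁻¹ * (4 * B)) := by
  have hφ1 : ∀ k, Integrable (φ k) P := fun k => integrable_of_integrable_sq (hφ k) (hφ2 k)
  have hG : ∀ a, Integrable (fun ω => (∑ k ∈ Finset.range a, g k ω) ^ 2) P := fun a =>
    Integrable.of_bound
      ((Finset.measurable_sum _ fun k _ => hg k).pow_const 2).aestronglyMeasurable ((a : ℝ) ^ 2)
      (ae_of_all _ fun ω => by
        rw [norm_pow, Real.norm_eq_abs]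
        exact pow_le_pow_left₀ (abs_nonneg _) (abs_sum_range_le (fun k => hbdd k ω) a) 2)
  have hd : ∀ k, Integrable (fun ω => |φ k ω - φ (k / L * L) ω|) P := fun k =>
    ((hφ1 _).sub (hφ1 _)).abs
  set G : ℕ → Ω → ℝ := fun a ω => ∑ k ∈ Finset.range a, g k ω
  have hG2 : ∀ a b, Integrable (fun ω => 2 * G a ω ^ 2 + 2 * G b ω ^ 2) P := fun a b =>
    ((hG a).const_mul 2).add ((hG b).const_mul 2)
  have hblock : ∀ j, Integrable (fun ω => η * φ (j * L) ω ^ 2 +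
      η⁻¹ * (2 * G (min ((j + 1) * L) m) ω ^ 2 + 2 * G (min (j * L) m) ω ^ 2)) P := fun j =>
    ((hφ2 _).const_mul _).add ((hG2 _ _).const_mul _)
  have hpt : ∀ ω, |∑ k ∈ Finset.range m, φ k ω * g k ω| ≤
      ∑ k ∈ Finset.range m, |φ k ω - φ (k / L * L) ω| +
      ∑ j ∈ Finset.range (m / L + 1), (η * φ (j * L) ω ^ 2 +
        η⁻¹ * (2 * G (min ((j + 1) * L) m) ω ^ 2 + 2 * G (min (j * L) m) ω ^ 2)) := by
    intro ω
    have hsplit : ∑ k ∈ Finset.range m, φ k ω * g k ω =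
        ∑ k ∈ Finset.range m, (φ k ω - φ (k / L * L) ω) * g k ω +
          ∑ k ∈ Finset.range m, φ (k / L * L) ω * g k ω := by
      rw [← Finset.sum_add_distrib]
      exact Finset.sum_congr rfl fun k _ => by ring
    have hmL : m ≤ (m / L + 1) * L := by
      rw [add_mul, one_mul]; exact (Nat.lt_div_mul_add hL).le
    rw [hsplit, sum_range_div_mul hL (fun j => φ (j * L) ω) (fun k => g k ω) _ m hmL]
    refine (abs_add_le _ _).trans (add_le_add ?_ ?_)
    · refine (Finset.abs_sum_le_sum_abs _ _).trans (Finset.sum_le_sum fun k _ => ?_)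
      rw [abs_mul]
      exact mul_le_of_le_one_right (abs_nonneg _) (hbdd k ω)
    · exact (Finset.abs_sum_le_sum_abs _ _).trans
        (Finset.sum_le_sum fun j _ => mul_abs_sub_le hη _ _ _)
  have hint1 : Integrable (fun ω => ∑ k ∈ Finset.range m, |φ k ω - φ (k / L * L) ω|) P :=
    integrable_finsetSum _ fun k _ => hd k
  have hint2 := integrable_finsetSum (Finset.range (m / L + 1)) fun j _ => hblock j
  refine (integral_mono_of_nonneg (ae_of_all _ fun ω => abs_nonneg _) (hint1.add hint2)
    (ae_of_all _ hpt)).trans ?_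
  simp only [Pi.add_apply]
  rw [integral_add hint1 hint2, integral_finsetSum _ fun k _ => hd k,
    integral_finsetSum _ fun j _ => hblock j]
  refine add_le_add ?_ ?_
  · refine (Finset.sum_le_card_nsmul _ _ (L * c) fun k hk => ?_).trans (by simp)
    have hk' := Finset.mem_range.1 hk
    have h := integral_abs_sub_le_mul hφ1 hlip (k / L * L) (k % L)
      (by rw [Nat.div_add_mod']; omega)
    rw [Nat.div_add_mod'] at h
    refine h.trans ?_
    gcongr
    exact (Nat.mod_lt _ hL).le
  · refine (Finset.sum_le_card_nsmul _ _ (η * C + η⁻¹ * (4 * B)) fun j hj => ?_).trans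
      (by rw [Finset.card_range, nsmul_eq_mul, Nat.cast_succ])
    have hj' : j * L ≤ m := (Nat.le_div_iff_mul_le hL).1 (Nat.lt_succ_iff.1 (Finset.mem_range.1 hj))
    rw [integral_add ((hφ2 _).const_mul _) ((hG2 _ _).const_mul _),
      integral_const_mul, integral_const_mul,
      integral_add ((hG _).const_mul 2) ((hG _).const_mul 2), integral_const_mul,
      integral_const_mul]
    have h1 := hL2 (j * L) (hj'.trans hm)
    have h2 := hB (min ((j + 1) * L) m) (min_le_right _ _)
    have h3 := hB (min (j * L) m) (min_le_right _ _)
    gcongr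
    linarith

/-- Uniform ergodic averaging for a single bounded sequence `g` with vanishing averages and slowly
varying weights `φ`. -/
theorem eventually_integral_abs_average_le [IsProbabilityMeasure P] {φ : ℕ → ℕ → Ω → ℝ} {g : ℕ → Ω → ℝ} {T C : ℝ}
    (hT : 0 < T) (hC : 0 ≤ C) (hφ : ∀ N k, Measurable (φ N k))
    (hφ2 : ∀ N k, Integrable (fun ω => φ N k ω ^ 2) P) (hg : ∀ k, Measurable (g k))
    (hbdd : ∀ k ω, |g k ω| ≤ 1)
    (hlim : TendstoInMeasure P (fun (N : ℕ) ω => (N : ℝ)⁻¹ * ∑ k ∈ Finset.range N, g k ω)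
      atTop (fun _ => 0))
    (hlip : ∀ N : ℕ, ∀ k, 1 ≤ k → k ≤ ⌊(N : ℝ) * T⌋₊ →
      ∫ ω, |φ N k ω - φ N (k - 1) ω| ∂P ≤ C / N)
    (hL2 : ∀ N : ℕ, ∀ k ≤ ⌊(N : ℝ) * T⌋₊, ∫ ω, φ N k ω ^ 2 ∂P ≤ C) {τ : ℝ} (hτ : 0 < τ) :
    ∀ᶠ N : ℕ in atTop, ∀ m ≤ ⌊(N : ℝ) * T⌋₊,
      (N : ℝ)⁻¹ * ∫ ω, |∑ k ∈ Finset.range m, φ N k ω * g k ω| ∂P ≤ τ := by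
  obtain ⟨p, hp⟩ := exists_nat_gt (T * C * 4 / τ)
  have hp0 : (0 : ℝ) < p := lt_of_le_of_lt (by positivity) hp
  have hp_pos : 0 < p := by exact_mod_cast hp0
  set D : ℝ := T * p + 1 with hD
  have hD0 : 0 < D := by positivity
  set η : ℝ := τ / (4 * D * (C + 1)) with hηdef
  have hη : 0 < η := by positivity
  set ε : ℝ := η * τ / (16 * D * T ^ 2) with hεdef
  have hε : 0 < ε := by positivity
  obtain ⟨K, hK0, hK⟩ := exists_integral_sq_sum_range_le hg hbdd hlim hε
  have hsmall : Tendsto (fun N : ℕ => T * C * (N : ℝ)⁻¹ +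
      D * (4 * η⁻¹ * K) * ((N : ℝ)⁻¹) ^ 2) atTop (nhds 0) := by
    have h := tendsto_inv_atTop_nhds_zero_nat (𝕜 := ℝ)
    simpa using (h.const_mul (T * C)).add ((h.pow 2).const_mul (D * (4 * η⁻¹ * K)))
  filter_upwards [hsmall.eventually_lt_const (show (0 : ℝ) < τ / 4 by positivity),
    eventually_gt_atTop 0] with N hN hN0 m hm
  have hNr : (0 : ℝ) < N := by exact_mod_cast hN0
  have hmT : (m : ℝ) ≤ N * T := (Nat.le_floor_iff (by positivity)).1 hm
  have hB : ∀ a ≤ m, ∫ ω, (∑ k ∈ Finset.range a, g k ω) ^ 2 ∂P ≤ ε * (N * T) ^ 2 + K := by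
    intro a ha
    have ha' : (a : ℝ) ≤ N * T := le_trans (by exact_mod_cast ha) hmT
    exact (hK a).trans (by gcongr)
  have hmain := integral_abs_sum_mul_le (hφ N) (hφ2 N) hg hbdd (by positivity) (hlip N) (hL2 N) hm
    (Nat.succ_pos (N / p)) (mul_pos hη hNr) hB
  have hL1 : ((N / p).succ : ℝ) ≤ N / p + 1 := by
    push_cast
    gcongr
    exact Nat.cast_div_le
  have hL3 : (N : ℝ) / p ≤ ((N / p).succ : ℝ) := by
    rw [div_le_iff₀ hp0]
    exact_mod_cast (Nat.lt_mul_of_div_lt (Nat.lt_succ_self _) hp_pos).le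
  have hblocks : ((m / (N / p).succ : ℕ) : ℝ) + 1 ≤ D := by
    have h1 : ((m / (N / p).succ : ℕ) : ℝ) ≤ (m : ℝ) / ((N / p).succ : ℝ) := Nat.cast_div_le
    have h2 : (m : ℝ) / ((N / p).succ : ℝ) ≤ (N * T) / (N / p) := by gcongr
    have h3 : (N * T) / ((N : ℝ) / p) = T * p := by field_simp
    linarith
  have hbound : (N : ℝ)⁻¹ * ∫ ω, |∑ k ∈ Finset.range m, φ N k ω * g k ω| ∂P ≤
      (N : ℝ)⁻¹ * (N * T * ((N / p + 1) * (C / N)) +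
        D * (η * N * C + (η * N)⁻¹ * (4 * (ε * (N * T) ^ 2 + K)))) := by
    refine mul_le_mul_of_nonneg_left (hmain.trans ?_) (by positivity)
    gcongr
  have hexpand : (N : ℝ)⁻¹ * (N * T * ((N / p + 1) * (C / N)) +
        D * (η * N * C + (η * N)⁻¹ * (4 * (ε * (N * T) ^ 2 + K)))) =
      T * C / p + D * η * C + 4 * D * η⁻¹ * ε * T ^ 2 +
        (T * C * (N : ℝ)⁻¹ + D * (4 * η⁻¹ * K) * ((N : ℝ)⁻¹) ^ 2) := by
    field_simp
    ring
  have e1 : T * C / p ≤ τ / 4 := by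
    rw [div_lt_iff₀ hτ] at hp
    rw [div_le_iff₀ hp0]
    linarith
  have e2 : D * η * C ≤ τ / 4 := by
    have h : D * η * (C + 1) = τ / 4 := by rw [hηdef]; field_simp
    have h' : 0 < D * η := by positivity
    linarith
  have e3 : 4 * D * η⁻¹ * ε * T ^ 2 = τ / 4 := by
    rw [hεdef]
    field_simp
    norm_num
  linarith

end ErgodicAveraging

/-- Lemma 6 (uniform-in-time ergodic averaging): under a `1/N`-Lipschitz-in-`k`
condition and a uniform `L²` bound on the random functions `f_k^N`, the fluctuation
terms `M_t^N = (1/N) Σ_{k<⌊Nt⌋} ( f_k^N(z_k) − Σ_s f_k^N(s) q(s) )` satisfy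
`lim_{N→∞} sup_{t∈(0,T]} E|M_t^N| = 0`. -/
theorem stmt_6
    {Ω : Type*} [MeasurableSpace Ω] (P : Measure Ω) [IsProbabilityMeasure P]
    {S : Type*} [Fintype S] [Nonempty S] [MeasurableSpace S] [MeasurableSingletonClass S]
    [DecidableEq S]
    (q : S → ℝ) (hq_nonneg : ∀ s, 0 ≤ q s) (hq_sum : ∑ s : S, q s = 1)
    (z : ℕ → Ω → S) (hz_meas : ∀ k, Measurable (z k))
    (hz_freq : ∀ s : S,
      TendstoInMeasure P
        (fun (N : ℕ) (ω : Ω) => (N : ℝ)⁻¹ * ∑ k ∈ Finset.range N, (if z k ω = s then (1 : ℝ) else 0))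
        atTop (fun _ => q s))
    (T : ℝ) (hT : 0 < T)
    (C : ℝ) (hC : 0 ≤ C)
    (f : ℕ → ℕ → Ω → S → ℝ)
    (hf_meas : ∀ N k s, Measurable (fun ω => f N k ω s))
    (hf_int : ∀ N k s, Integrable (fun ω => (f N k ω s) ^ 2) P)
    (hf_lip : ∀ N : ℕ, ∀ k : ℕ, 1 ≤ k → k ≤ ⌊(N : ℝ) * T⌋₊ → ∀ s : S,
      ∫ ω, |f N k ω s - f N (k - 1) ω s| ∂P ≤ C / N)
    (hf_L2 : ∀ N : ℕ, ∀ k : ℕ, k ≤ ⌊(N : ℝ) * T⌋₊ → ∀ s : S,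
      ∫ ω, (f N k ω s) ^ 2 ∂P ≤ C) :
    Tendsto
      (fun N : ℕ => ⨆ t : Set.Ioc (0 : ℝ) T,
        ∫ ω, |(N : ℝ)⁻¹ * ∑ k ∈ Finset.range ⌊(N : ℝ) * (t : ℝ)⌋₊,
          (f N k ω (z k ω) - ∑ s : S, f N k ω s * q s)| ∂P)
      atTop (nhds 0) := by
  have hq_le : ∀ s, q s ≤ 1 := fun s =>
    hq_sum ▸ Finset.single_le_sum (fun i _ => hq_nonneg i) (Finset.mem_univ s)
  set g : S → ℕ → Ω → ℝ := fun s k ω => (if z k ω = s then (1 : ℝ) else 0) - q s with hg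
  have hg_meas : ∀ s k, Measurable (g s k) := fun s k =>
    (Measurable.ite (hz_meas k (measurableSet_singleton s)) measurable_const
      measurable_const).sub_const _
  have hg_bdd : ∀ s k ω, |g s k ω| ≤ 1 := by
    intro s k ω
    have h0 := hq_nonneg s
    have h1 := hq_le s
    simp only [hg]
    split_ifs <;> rw [abs_le] <;> constructor <;> linarith
  have hg_lim : ∀ s, TendstoInMeasure P
      (fun (N : ℕ) ω => (N : ℝ)⁻¹ * ∑ k ∈ Finset.range N, g s k ω) atTop (fun _ => 0) := by
    intro s ε hε
    refine (hz_freq s ε hε).congr' ?_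
    filter_upwards [eventually_gt_atTop 0] with N hN
    have hN' : (N : ℝ) ≠ 0 := by exact_mod_cast hN.ne'
    congr 1
    ext ω
    simp only [hg, Set.mem_ofPred_eq, edist_dist, Real.dist_eq, Finset.sum_sub_distrib,
      Finset.sum_const, Finset.card_range, nsmul_eq_mul, mul_sub, inv_mul_cancel_left₀ hN', sub_zero]
  have hcard : (0 : ℝ) < Fintype.card S := by exact_mod_cast Fintype.card_pos
  have : Nonempty (Set.Ioc (0 : ℝ) T) := ⟨⟨T, hT, le_rfl⟩⟩
  have hterm : ∀ N m ω, ∑ k ∈ Finset.range m, (f N k ω (z k ω) - ∑ s : S, f N k ω s * q s) =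
      ∑ s : S, ∑ k ∈ Finset.range m, f N k ω s * g s k ω := by
    intro N m ω
    rw [Finset.sum_comm]
    refine Finset.sum_congr rfl fun k _ => ?_
    simp [hg, mul_sub, Finset.sum_sub_distrib]
  have hint : ∀ N m s,
      Integrable (fun ω => |∑ k ∈ Finset.range m, f N k ω s * g s k ω|) P := fun N m s =>
    (integrable_finsetSum _ fun k _ =>
      (integrable_of_integrable_sq (hf_meas N k s) (hf_int N k s)).mul_bdd
        (hg_meas s k).aestronglyMeasurable (ae_of_all _ (hg_bdd s k))).abs
  rw [Metric.tendsto_atTop']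
  intro τ hτ
  have hev := eventually_all.2 fun s : S => eventually_integral_abs_average_le
    (φ := fun N k ω => f N k ω s) hT hC (fun N k => hf_meas N k s) (fun N k => hf_int N k s)
    (hg_meas s) (hg_bdd s) (hg_lim s) (fun N k h1 h2 => hf_lip N k h1 h2 s)
    (fun N k h => hf_L2 N k h s) (show 0 < τ / 2 / Fintype.card S by positivity)
  obtain ⟨N₀, hN₀⟩ := eventually_atTop.1 hev
  refine ⟨N₀, fun N hN => ?_⟩
  have hnonneg : 0 ≤ ⨆ t : Set.Ioc (0 : ℝ) T,
      ∫ ω, |(N : ℝ)⁻¹ * ∑ k ∈ Finset.range ⌊(N : ℝ) * (t : ℝ)⌋₊,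
        (f N k ω (z k ω) - ∑ s : S, f N k ω s * q s)| ∂P :=
    Real.iSup_nonneg fun t => integral_nonneg fun ω => abs_nonneg _
  rw [Real.dist_eq, sub_zero, abs_of_nonneg hnonneg]
  refine lt_of_le_of_lt (ciSup_le fun t => ?_) (half_lt_self hτ)
  have hm : ⌊(N : ℝ) * (t : ℝ)⌋₊ ≤ ⌊(N : ℝ) * T⌋₊ :=
    Nat.floor_le_floor (mul_le_mul_of_nonneg_left t.2.2 N.cast_nonneg)
  generalize ⌊(N : ℝ) * (t : ℝ)⌋₊ = m at hm
  simp_rw [hterm, abs_mul, abs_inv, Nat.abs_cast]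
  rw [integral_const_mul]
  calc (N : ℝ)⁻¹ * ∫ ω, |∑ s : S, ∑ k ∈ Finset.range m, f N k ω s * g s k ω| ∂P
      ≤ (N : ℝ)⁻¹ * ∫ ω, ∑ s : S, |∑ k ∈ Finset.range m, f N k ω s * g s k ω| ∂P := by
        refine mul_le_mul_of_nonneg_left ?_ (by positivity)
        exact integral_mono_of_nonneg (ae_of_all _ fun ω => abs_nonneg _)
          (integrable_finsetSum _ fun s _ => hint N m s)
          (ae_of_all _ fun ω => Finset.abs_sum_le_sum_abs _ _)
    _ = ∑ s : S, (N : ℝ)⁻¹ * ∫ ω, |∑ k ∈ Finset.range m, f N k ω s * g s k ω| ∂P := by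
        rw [integral_finsetSum _ fun s _ => hint N m s, Finset.mul_sum]
    _ ≤ ∑ _s : S, τ / 2 / Fintype.card S := Finset.sum_le_sum fun s _ => hN₀ N hN.le s m hm
    _ = τ / 2 := by
        rw [Finset.sum_const, Finset.card_univ, nsmul_eq_mul]
        field_simp
end

section
/- Suppose in addition that |r(x,a)| ≤ R for all (x,a), |C_0^i| ≤ B almost surely, and E‖W_0^i‖ ≤ B for all i. Then there exists a constant C < ∞, depending only on T, α, γ, R, B, ‖σ‖_∞ and ‖σ'‖_∞ (and not on N, i, or k), such that for every N ≥ 1, every 1 ≤ i ≤ N, and every 0 ≤ k ≤ ⌊NT⌋: |C_k^i| ≤ C almost surely, and E‖W_k^i‖ ≤ C. -/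
open MeasureTheory Matrix Filter
open scoped RealInnerProductSpace

/-- Setup for infinite-horizon Q-learning with a single-layer neural network of
`N` hidden units, trained with learning rate `α/N`.  `C N k i` and `W N k i` are
the parameters of the `i`-th hidden unit after `k` training steps, `xa k` is the
state-action sample at step `k` (so that `(xa (k+1)).1` is the state following
`(x_k, a_k)`), `emb (x,a)` is the concatenated vector `(x,a) ∈ ℝ^d`. -/
structure QLearning (Ω : Type*) [MeasurableSpace Ω]
    (𝒳 𝒜 : Type*) [Fintype 𝒳] [Fintype 𝒜] [Nonempty 𝒳] [Nonempty 𝒜]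
    [MeasurableSpace 𝒳] [MeasurableSpace 𝒜] (d : ℕ) where
  P : Measure Ω
  P_prob : IsProbabilityMeasure P
  σ : ℝ → ℝ
  σ_smooth : ContDiff ℝ 2 σ
  Cσ : ℝ
  σ_bdd : ∀ y, |σ y| ≤ Cσ
  σ'_bdd : ∀ y, |deriv σ y| ≤ Cσ
  σ''_bdd : ∀ y, |deriv (deriv σ) y| ≤ Cσ
  emb : 𝒳 × 𝒜 → EuclideanSpace ℝ (Fin d)
  r : 𝒳 × 𝒜 → ℝ
  γ : ℝ
  γ_pos : 0 < γ
  γ_le_one : γ ≤ 1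
  α : ℝ
  α_pos : 0 < α
  xa : ℕ → Ω → 𝒳 × 𝒜
  xa_meas : ∀ k, Measurable (xa k)
  C : ℕ → ℕ → ℕ → Ω → ℝ
  W : ℕ → ℕ → ℕ → Ω → EuclideanSpace ℝ (Fin d)
  C0_meas : ∀ N i, Measurable (C N 0 i)
  W0_meas : ∀ N i, Measurable (W N 0 i)

variable {Ω : Type*} [MeasurableSpace Ω] {𝒳 𝒜 : Type*} [Fintype 𝒳] [Fintype 𝒜]
  [Nonempty 𝒳] [Nonempty 𝒜] [MeasurableSpace 𝒳] [MeasurableSpace 𝒜] {d : ℕ}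

/-- The neural network ("Q-network") output
`Q_k^N(x,a) = N^{-1/2} Σ_{i<N} C_k^i σ(W_k^i · (x,a))`. -/
noncomputable def QLearning.Q (q : QLearning Ω 𝒳 𝒜 d) (N k : ℕ) (ω : Ω)
    (ζ : 𝒳 × 𝒜) : ℝ :=
  (Real.sqrt N)⁻¹ * ∑ i ∈ Finset.range N, q.C N k i ω * q.σ ⟪q.W N k i ω, q.emb ζ⟫

/-- The temporal-difference error
`r(x_k,a_k) + γ max_{a'} Q_k^N(x_{k+1},a') − Q_k^N(x_k,a_k)`. -/
noncomputable def QLearning.D (q : QLearning Ω 𝒳 𝒜 d) (N k : ℕ) (ω : Ω) : ℝ :=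
  q.r (q.xa k ω) + q.γ * (⨆ a' : 𝒜, q.Q N k ω ((q.xa (k + 1) ω).1, a')) -
    q.Q N k ω (q.xa k ω)

/-- The Q-learning parameter updates with learning rate `α/N`:
`C_{k+1}^i = C_k^i + (α/N^{3/2}) D_k σ(W_k^i·ζ_k)` and
`W_{k+1}^i = W_k^i + (α/N^{3/2}) D_k C_k^i σ'(W_k^i·ζ_k) ζ_k`. -/
def QLearning.Dyn (q : QLearning Ω 𝒳 𝒜 d) : Prop :=
  ∀ N k i, i < N → ∀ ω,
    q.C N (k + 1) i ω =
      q.C N k i ω + q.α / (N : ℝ) ^ (3 / 2 : ℝ) * q.D N k ω *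
        q.σ ⟪q.W N k i ω, q.emb (q.xa k ω)⟫ ∧
    q.W N (k + 1) i ω =
      q.W N k i ω + (q.α / (N : ℝ) ^ (3 / 2 : ℝ) * q.D N k ω * q.C N k i ω *
        deriv q.σ ⟪q.W N k i ω, q.emb (q.xa k ω)⟫) • q.emb (q.xa k ω)

/-- The time-rescaled network output `h_t^N = Q^N_{⌊Nt⌋}`. -/
noncomputable def QLearning.h (q : QLearning Ω 𝒳 𝒜 d) (N : ℕ) (t : ℝ) (ω : Ω)
    (ζ : 𝒳 × 𝒜) : ℝ :=
  q.Q N ⌊(N : ℝ) * t⌋₊ ω ζ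

/-- The σ-algebra `F_s^N` generated by the initial parameters `(C_0^i, W_0^i)_{i<N}`
and the samples `(x_k, a_k, x_{k+1})` for `k < ⌊Ns⌋`. -/
def QLearning.F (q : QLearning Ω 𝒳 𝒜 d) (N : ℕ) (s : ℝ) : MeasurableSpace Ω :=
  (⨆ i ∈ Finset.range N,
    MeasurableSpace.comap (fun ω => (q.C N 0 i ω, q.W N 0 i ω)) inferInstance) ⊔
  (⨆ k ∈ Finset.range ⌊(N : ℝ) * s⌋₊,
    MeasurableSpace.comap (fun ω => (q.xa k ω, (q.xa (k + 1) ω).1)) inferInstance)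

namespace QLearning

lemma Cσ_nonneg (q : QLearning Ω 𝒳 𝒜 d) : 0 ≤ q.Cσ :=
  (abs_nonneg _).trans (q.σ_bdd 0)

lemma abs_Q_le (q : QLearning Ω 𝒳 𝒜 d) {N k : ℕ} {ω : Ω} {M : ℝ} (hM : 0 ≤ M)
    (hC : ∀ i < N, |q.C N k i ω| ≤ M) (ζ : 𝒳 × 𝒜) :
    |q.Q N k ω ζ| ≤ √N * (M * q.Cσ) := by
  have hsum : |∑ i ∈ Finset.range N, q.C N k i ω * q.σ ⟪q.W N k i ω, q.emb ζ⟫| ≤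
      N * (M * q.Cσ) := by
    refine (Finset.abs_sum_le_sum_abs _ _).trans ?_
    refine (Finset.sum_le_card_nsmul _ _ (M * q.Cσ) fun i hi => ?_).trans (by simp)
    rw [abs_mul]
    exact mul_le_mul (hC i (Finset.mem_range.1 hi)) (q.σ_bdd _) (abs_nonneg _) hM
  rw [Q, abs_mul, abs_of_nonneg (by positivity : 0 ≤ (√(N : ℝ))⁻¹)]
  calc (√(N : ℝ))⁻¹ * _ ≤ (√(N : ℝ))⁻¹ * (N * (M * q.Cσ)) := by gcongr
    _ = √N * (M * q.Cσ) := by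
      rw [← mul_assoc, inv_mul_eq_div, Real.div_sqrt]

lemma abs_D_le (q : QLearning Ω 𝒳 𝒜 d) {R : ℝ} (hr : ∀ ζ, |q.r ζ| ≤ R)
    {N k : ℕ} {ω : Ω} {M : ℝ} (hM : 0 ≤ M) (hC : ∀ i < N, |q.C N k i ω| ≤ M) :
    |q.D N k ω| ≤ R + 2 * (√N * (M * q.Cσ)) := by
  have hQ := q.abs_Q_le hM hC
  have hS : |⨆ a' : 𝒜, q.Q N k ω ((q.xa (k + 1) ω).1, a')| ≤ √N * (M * q.Cσ) := by
    obtain ⟨a, ha⟩ := exists_eq_ciSup_of_finite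
      (f := fun a' : 𝒜 => q.Q N k ω ((q.xa (k + 1) ω).1, a'))
    rw [← ha]
    exact hQ _
  have hγ : |q.γ * ⨆ a' : 𝒜, q.Q N k ω ((q.xa (k + 1) ω).1, a')| ≤ √N * (M * q.Cσ) := by
    rw [abs_mul, abs_of_pos q.γ_pos]
    exact (mul_le_of_le_one_left (abs_nonneg _) q.γ_le_one).trans hS
  rw [D]
  have h₁ := abs_le.1 (hr (q.xa k ω))
  have h₂ := abs_le.1 (hQ (q.xa k ω))
  have h₃ := abs_le.1 hγ
  exact abs_le.2 ⟨by linarith, by linarith⟩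

/-- The growth rate of the output weights, per unit of rescaled time. -/
def rate (q : QLearning Ω 𝒳 𝒜 d) (R : ℝ) : ℝ :=
  q.α * q.Cσ * (R + 2 * q.Cσ)

lemma rate_nonneg (q : QLearning Ω 𝒳 𝒜 d) {R : ℝ} (hR : 0 ≤ R) : 0 ≤ q.rate R := by
  have := q.Cσ_nonneg
  have := q.α_pos
  unfold rate
  positivity

lemma abs_step_mul_le (q : QLearning Ω 𝒳 𝒜 d) {R : ℝ} (hR : 0 ≤ R)
    (hr : ∀ ζ, |q.r ζ| ≤ R) {N k : ℕ} (hN : 1 ≤ N) {ω : Ω} {M : ℝ} (hM : 1 ≤ M)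
    (hC : ∀ i < N, |q.C N k i ω| ≤ M) {s : ℝ} (hs : |s| ≤ q.Cσ) :
    |q.α / (N : ℝ) ^ (3 / 2 : ℝ) * q.D N k ω * s| ≤ q.rate R / N * M := by
  have hN' : (1 : ℝ) ≤ N := by exact_mod_cast hN
  have hN0 : (0 : ℝ) < N := by linarith
  have hσ := q.Cσ_nonneg
  have hα := q.α_pos
  have hsq : (1 : ℝ) ≤ √N := Real.one_le_sqrt.2 hN'
  have hpow : (N : ℝ) ^ (3 / 2 : ℝ) = N * √N := by
    rw [Real.sqrt_eq_rpow, ← Real.rpow_one_add' hN0.le (by norm_num)]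
    norm_num
  have hD : |q.D N k ω| ≤ √N * (M * (R + 2 * q.Cσ)) := by
    have h₁ : 1 ≤ √N * M := one_le_mul_of_one_le_of_one_le hsq hM
    have h₂ := q.abs_D_le hr (by linarith : 0 ≤ M) hC
    nlinarith [mul_le_mul_of_nonneg_right h₁ hR]
  rw [hpow, abs_mul, abs_mul, abs_of_pos (by positivity : 0 < q.α / (N * √N))]
  calc q.α / (N * √N) * |q.D N k ω| * |s|
      ≤ q.α / (N * √N) * (√N * (M * (R + 2 * q.Cσ))) * q.Cσ := by gcongr
    _ = q.rate R / N * M := by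
      unfold rate
      field_simp

lemma abs_C_le_mul_pow (q : QLearning Ω 𝒳 𝒜 d) (hdyn : q.Dyn) {R : ℝ} (hR : 0 ≤ R)
    (hr : ∀ ζ, |q.r ζ| ≤ R) {N : ℕ} (hN : 1 ≤ N) {ω : Ω} {M : ℝ} (hM : 1 ≤ M)
    (hC : ∀ i < N, |q.C N 0 i ω| ≤ M) (k : ℕ) :
    ∀ i < N, |q.C N k i ω| ≤ M * (1 + q.rate R / N) ^ k := by
  induction k with
  | zero => simpa using hC
  | succ k ih =>
    intro i hi
    have hc : 0 ≤ q.rate R / N := div_nonneg (q.rate_nonneg hR) (Nat.cast_nonneg N)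
    have hone : 1 ≤ M * (1 + q.rate R / N) ^ k :=
      one_le_mul_of_one_le_of_one_le hM (one_le_pow₀ (by linarith))
    rw [(hdyn N k i hi ω).1]
    calc _ ≤ |q.C N k i ω| + _ := abs_add_le _ _
      _ ≤ M * (1 + q.rate R / N) ^ k + q.rate R / N * (M * (1 + q.rate R / N) ^ k) :=
        add_le_add (ih i hi) (q.abs_step_mul_le hR hr hN hone ih (q.σ_bdd _))
      _ = M * (1 + q.rate R / N) ^ (k + 1) := by ring

lemma abs_C_le_mul_exp (q : QLearning Ω 𝒳 𝒜 d) (hdyn : q.Dyn) {R : ℝ} (hR : 0 ≤ R)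
    (hr : ∀ ζ, |q.r ζ| ≤ R) {N : ℕ} (hN : 1 ≤ N) {ω : Ω} {M : ℝ} (hM : 1 ≤ M)
    (hC : ∀ i < N, |q.C N 0 i ω| ≤ M) {T : ℝ} {k : ℕ} (hk : (k : ℝ) ≤ N * T) :
    ∀ i < N, |q.C N k i ω| ≤ M * Real.exp (q.rate R * T) := by
  intro i hi
  have hN0 : (0 : ℝ) < N := by exact_mod_cast hN
  have hc := q.rate_nonneg hR
  refine (q.abs_C_le_mul_pow hdyn hR hr hN hM hC k i hi).trans ?_
  gcongr
  calc (1 + q.rate R / N) ^ k ≤ Real.exp (q.rate R / N) ^ k := by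
        gcongr
        rw [add_comm]
        exact Real.add_one_le_exp _
    _ = Real.exp (k * (q.rate R / N)) := (Real.exp_nat_mul _ _).symm
    _ ≤ Real.exp (q.rate R * T) := by
        refine Real.exp_le_exp.2 ?_
        calc k * (q.rate R / N) ≤ N * T * (q.rate R / N) := by gcongr
          _ = q.rate R * T := by field_simp

lemma norm_W_sub_le (q : QLearning Ω 𝒳 𝒜 d) (hdyn : q.Dyn) {R : ℝ} (hR : 0 ≤ R)
    (hr : ∀ ζ, |q.r ζ| ≤ R) {N : ℕ} (hN : 1 ≤ N) {ω : Ω} {M : ℝ} (hM : 1 ≤ M)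
    {E : ℝ} (hE : ∀ ζ, ‖q.emb ζ‖ ≤ E) {k : ℕ}
    (hC : ∀ j < k, ∀ i < N, |q.C N j i ω| ≤ M) {i : ℕ} (hi : i < N) :
    ‖q.W N k i ω - q.W N 0 i ω‖ ≤ k * (q.rate R / N * M * M * E) := by
  rw [← Finset.sum_range_sub (fun j => q.W N j i ω)]
  refine (norm_sum_le _ _).trans ?_
  refine (Finset.sum_le_card_nsmul _ _ (q.rate R / N * M * M * E) fun j hj => ?_).trans
    (by simp)
  have hCj := hC j (Finset.mem_range.1 hj)
  have hstep := q.abs_step_mul_le hR hr hN hM hCj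
    (q.σ'_bdd ⟪q.W N j i ω, q.emb (q.xa j ω)⟫)
  have hc := q.rate_nonneg hR
  rw [(hdyn N j i hi ω).2, add_sub_cancel_left, norm_smul, Real.norm_eq_abs,
    mul_right_comm, abs_mul]
  have := hCj i hi
  have := hE (q.xa j ω)
  gcongr

end QLearning

/-- Lemma (a priori bounds on the parameters): if the reward is bounded by `R`, the
initial `C_0^i` are bounded by `B` a.s. and `E‖W_0^i‖ ≤ B`, then there is a constant
`C < ∞`, independent of `N`, `i` and `k`, such that `|C_k^i| ≤ C` a.s. and
`E‖W_k^i‖ ≤ C` for all `N ≥ 1`, `i < N`, `k ≤ ⌊NT⌋`. -/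
theorem stmt_7 (q : QLearning Ω 𝒳 𝒜 d) (hdyn : q.Dyn)
    (T : ℝ) (hT : 0 < T)
    (R : ℝ) (hr : ∀ ζ, |q.r ζ| ≤ R)
    (B : ℝ) (hB : 0 < B)
    (hC0 : ∀ N i, i < N → ∀ᵐ ω ∂q.P, |q.C N 0 i ω| ≤ B)
    (hW0 : ∀ N i, i < N → ∫ ω, ‖q.W N 0 i ω‖ ∂q.P ≤ B) :
    ∃ C : ℝ, ∀ N : ℕ, 1 ≤ N → ∀ i < N, ∀ k ≤ ⌊(N : ℝ) * T⌋₊,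
      (∀ᵐ ω ∂q.P, |q.C N k i ω| ≤ C) ∧ ∫ ω, ‖q.W N k i ω‖ ∂q.P ≤ C := by
  have := q.P_prob
  have hR : 0 ≤ R := (abs_nonneg _).trans (hr (Classical.arbitrary _))
  obtain ⟨E, hE⟩ := (Set.finite_range fun ζ => ‖q.emb ζ‖).bddAbove
  replace hE : ∀ ζ, ‖q.emb ζ‖ ≤ E := fun ζ => hE ⟨ζ, rfl⟩
  have hE0 : 0 ≤ E := (norm_nonneg _).trans (hE (Classical.arbitrary _))
  have hc := q.rate_nonneg hR
  set M : ℝ := (B + 1) * Real.exp (q.rate R * T) with hMdef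
  have hM : 1 ≤ M :=
    one_le_mul_of_one_le_of_one_le (by linarith) (Real.one_le_exp (by positivity))
  set L : ℝ := q.rate R * T * M * M * E with hLdef
  have hL : 0 ≤ L := by positivity
  refine ⟨M + B + L, fun N hN i hi k hk => ?_⟩
  have hN0 : (0 : ℝ) < N := by exact_mod_cast hN
  have hkT : (k : ℝ) ≤ N * T := (Nat.le_floor_iff (by positivity)).1 hk
  have hinit : ∀ᵐ ω ∂q.P, ∀ i < N, |q.C N 0 i ω| ≤ B := by
    simp only [ae_all_iff]
    exact fun i hi => hC0 N i hi
  have hbound : ∀ᵐ ω ∂q.P, ∀ j ≤ k, ∀ i < N, |q.C N j i ω| ≤ M := by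
    filter_upwards [hinit] with ω hω j hj
    exact q.abs_C_le_mul_exp hdyn hR hr hN (by linarith)
      (fun i hi => (hω i hi).trans (by linarith)) ((Nat.cast_le.2 hj).trans hkT)
  refine ⟨hbound.mono fun ω hω => (hω k le_rfl i hi).trans (by linarith), ?_⟩
  have hdiff : ∀ᵐ ω ∂q.P, ‖q.W N k i ω - q.W N 0 i ω‖ ≤ L := by
    filter_upwards [hbound] with ω hω
    refine (q.norm_W_sub_le hdyn hR hr hN hM hE (fun j hj => hω j hj.le) hi).trans ?_
    calc (k : ℝ) * (q.rate R / N * M * M * E) ≤ N * T * (q.rate R / N * M * M * E) := by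
          gcongr
      _ = L := by
          rw [hLdef]
          field_simp
  by_cases hint : Integrable (fun ω => ‖q.W N 0 i ω‖) q.P
  · calc ∫ ω, ‖q.W N k i ω‖ ∂q.P ≤ ∫ ω, (‖q.W N 0 i ω‖ + L) ∂q.P := by
          refine integral_mono_of_nonneg (ae_of_all _ fun ω => norm_nonneg _)
            (hint.add (integrable_const L)) ?_
          filter_upwards [hdiff] with ω hω
          have := norm_sub_norm_le (q.W N k i ω) (q.W N 0 i ω)
          linarith
      _ = ∫ ω, ‖q.W N 0 i ω‖ ∂q.P + L := by
          rw [integral_add hint (integrable_const L)]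
          simp
      _ ≤ M + B + L := by linarith [hW0 N i hi]
  · have hint' : ¬ Integrable (fun ω => ‖q.W N k i ω‖) q.P := fun h => hint <| by
      refine (h.add (integrable_const L)).mono'
        (q.W0_meas N i).norm.aestronglyMeasurable ?_
      filter_upwards [hdiff] with ω hω
      have := norm_sub_norm_le (q.W N 0 i ω) (q.W N k i ω)
      rw [norm_sub_rev] at this
      simp only [norm_norm, Pi.add_apply]
      linarith
    rw [integral_undef hint']
    linarith
end

section
/- Let h : [0,∞) → ℝ^({0,…,J}×𝒳×𝒜) be a solution of the finite-horizon limit ODE (with arbitrary initial condition at the times j = 0,…,J−1 and h_t(J,x,a) = r(J,x) for all t). Then lim_{t→∞} sup_{j,x,a} |h_t(j,x,a) − V(j,x,a)| = 0, where V is the unique solution of the finite-horizon Bellman equation. -/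
open Matrix Filter

/-- A function satisfying the differential inequality `W' ≤ -c W + ε` with `c > 0` and a forcing
term `ε` that is eventually small is eventually small. -/
theorem eventually_lt_of_deriv_le_neg_mul_add {W W' ε : ℝ → ℝ} {c : ℝ} (hc : 0 < c)
    (hW : ∀ t, 0 ≤ t → HasDerivAt W (W' t) t)
    (hle : ∀ t, 0 ≤ t → W' t ≤ -c * W t + ε t)
    (hε : Tendsto ε atTop (nhds 0)) {δ : ℝ} (hδ : 0 < δ) :
    ∀ᶠ t in atTop, W t < δ := by
  obtain ⟨T, hT⟩ := eventually_atTop.1 (hε.eventually_lt_const (show 0 < c * (δ / 2) by positivity))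
  set S := max T 0
  have hderiv : ∀ t, 0 ≤ t → HasDerivAt (fun s => Real.exp (c * s) * (W s - δ / 2))
      (Real.exp (c * t) * (c * 1) * (W t - δ / 2) + Real.exp (c * t) * W' t) t := fun t ht =>
    (((hasDerivAt_id t).const_mul c).exp).mul ((hW t ht).sub_const _)
  have hanti : AntitoneOn (fun s => Real.exp (c * s) * (W s - δ / 2)) (Set.Ici S) := by
    refine antitoneOn_of_hasDerivWithinAt_nonpos (convex_Ici S)
      (fun t ht => (hderiv t ((le_max_right _ _).trans ht)).continuousAt.continuousWithinAt)
      (fun t ht => (hderiv t ((le_max_right _ _).trans (interior_subset ht))).hasDerivWithinAt)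
      (fun t ht => ?_)
    have htS : S ≤ t := interior_subset ht
    have h1 := hle t ((le_max_right _ _).trans htS)
    have h2 := hT t ((le_max_left _ _).trans htS)
    have h3 : c * (W t - δ / 2) + W' t ≤ 0 := by linarith
    calc _ = Real.exp (c * t) * (c * (W t - δ / 2) + W' t) := by ring
      _ ≤ 0 := mul_nonpos_of_nonneg_of_nonpos (Real.exp_pos _).le h3
  have hexp : Tendsto (fun t => Real.exp (c * t)) atTop atTop :=
    Real.tendsto_exp_atTop.comp (tendsto_id.const_mul_atTop hc)
  have hlarge := hexp.eventually_gt_atTop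
    ((Real.exp (c * S) * (W S - δ / 2)) / (δ / 2))
  filter_upwards [hlarge, eventually_ge_atTop S] with t ht htS
  have h1 := hanti Set.self_mem_Ici htS htS
  rw [div_lt_iff₀ (by positivity)] at ht
  have h2 : Real.exp (c * t) * (W t - δ / 2) < Real.exp (c * t) * (δ / 2) := h1.trans_lt ht
  linarith [lt_of_mul_lt_mul_left h2 (Real.exp_pos _).le]

/-- Cauchy–Schwarz for the quadratic form of the inverse of a positive definite matrix: each
coordinate is controlled by the form. -/
theorem Matrix.PosDef.sq_le_diag_mul_inv_form {ι : Type*} [Fintype ι] [DecidableEq ι]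
    {A : Matrix ι ι ℝ} (hA : A.PosDef) (x : ι → ℝ) (i : ι) :
    x i ^ 2 ≤ A i i * (x ⬝ᵥ A⁻¹ *ᵥ x) := by
  have hdet : IsUnit A.det := hA.det_pos.ne'.isUnit
  have hpos : 0 < A i i := hA.diag_pos
  have hinv : A⁻¹ *ᵥ (A *ᵥ Pi.single i 1) = Pi.single i 1 := by
    rw [mulVec_mulVec, nonsing_inv_mul _ hdet, one_mulVec]
  have hsymm : (A⁻¹)ᵀ = A⁻¹ := by simpa using hA.inv.isHermitian.eq
  have hcross : (A *ᵥ Pi.single i 1) ⬝ᵥ A⁻¹ *ᵥ x = x i := by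
    rw [dotProduct_mulVec, ← mulVec_transpose, hsymm, hinv, single_one_dotProduct]
  have hnonneg := hA.inv.posSemidef.dotProduct_mulVec_nonneg
    (x - (x i / A i i) • (A *ᵥ Pi.single i 1))
  have hdiag : (A *ᵥ Pi.single i 1) i = A i i := by simp
  simp only [star_trivial, mulVec_sub, mulVec_smul, sub_dotProduct, dotProduct_sub,
    smul_dotProduct, dotProduct_smul, hinv, hcross, dotProduct_single_one, Pi.sub_apply,
    Pi.smul_apply, hdiag, smul_eq_mul, div_mul_cancel₀ _ hpos.ne', sub_self, mul_zero,
    sub_zero] at hnonneg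
  rw [div_mul_eq_mul_div, sub_nonneg, div_le_iff₀ hpos] at hnonneg
  linarith

/-- A quadratic form is bounded by a multiple of the sum of squares. -/
theorem Matrix.form_le_sum_abs_mul_sum_sq {ι : Type*} [Fintype ι] (B : Matrix ι ι ℝ)
    (x : ι → ℝ) :
    x ⬝ᵥ B *ᵥ x ≤ (∑ i, ∑ k, |B i k|) * ∑ i, x i ^ 2 := by
  simp only [dotProduct, mulVec]
  rw [Finset.sum_mul]
  refine Finset.sum_le_sum fun i _ => ?_
  rw [Finset.mul_sum _ _ (x i), Finset.sum_mul]
  refine Finset.sum_le_sum fun k _ => ?_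
  have hsq : ∀ l, x l ^ 2 ≤ ∑ i, x i ^ 2 := fun l =>
    Finset.single_le_sum (fun i _ => sq_nonneg (x i)) (Finset.mem_univ l)
  have hprod : |x i * x k| ≤ ∑ i, x i ^ 2 := by
    have h1 := hsq i
    have h2 := hsq k
    rw [abs_le]
    constructor <;> nlinarith [sq_nonneg (x i - x k), sq_nonneg (x i + x k)]
  calc x i * (B i k * x k) = B i k * (x i * x k) := by ring
    _ ≤ |B i k| * |x i * x k| := by rw [← abs_mul]; exact le_abs_self _
    _ ≤ |B i k| * ∑ i, x i ^ 2 := by gcongr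

/-- Solutions of `g' = A D (f - g)`, with `A` positive definite, `D` a positive diagonal matrix and
`f → 0`, tend to zero. -/
theorem Matrix.PosDef.tendsto_zero_of_hasDerivAt {ι : Type*} [Fintype ι] [DecidableEq ι]
    {A : Matrix ι ι ℝ} (hA : A.PosDef) {w : ι → ℝ} (hw : ∀ i, 0 < w i) {f g : ℝ → ι → ℝ}
    (hg : ∀ i t, 0 ≤ t →
      HasDerivAt (fun s => g s i) (∑ k, w k * A i k * (f t k - g t k)) t)
    (hf : ∀ i, Tendsto (fun t => f t i) atTop (nhds 0)) (i : ι) :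
    Tendsto (fun t => g t i) atTop (nhds 0) := by
  have hdet : IsUnit A.det := hA.det_pos.ne'.isUnit
  have hsymm : (A⁻¹)ᵀ = A⁻¹ := by simpa using hA.inv.isHermitian.eq
  have : Nonempty ι := ⟨i⟩
  obtain ⟨i₀, hi₀⟩ := Finite.exists_min w
  set C := ∑ i, ∑ k, |A⁻¹ i k|
  have hC0 : 0 ≤ C := Finset.sum_nonneg fun i _ => Finset.sum_nonneg fun k _ => abs_nonneg _
  set v : ℝ → ι → ℝ := fun t k => w k * (f t k - g t k) with hv
  have hgv : ∀ t, 0 ≤ t → HasDerivAt g (A *ᵥ v t) t := fun t ht => by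
    refine hasDerivAt_pi.2 fun k => ?_
    have hk : (A *ᵥ v t) k = ∑ l, w l * A k l * (f t l - g t l) := by
      simp only [mulVec, dotProduct, hv]
      exact Finset.sum_congr rfl fun l _ => by ring
    rw [hk]
    exact hg k t ht
  have hW : ∀ t, 0 ≤ t → HasDerivAt (fun s => g s ⬝ᵥ A⁻¹ *ᵥ g s) (2 * (g t ⬝ᵥ v t)) t := by
    intro t ht
    have hcomp := hasDerivAt_pi.1 (hgv t ht)
    have hBg : ∀ k, HasDerivAt (fun s => (A⁻¹ *ᵥ g s) k) ((A⁻¹ *ᵥ (A *ᵥ v t)) k) t := fun k => by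
      simp only [mulVec, dotProduct]
      exact HasDerivAt.fun_sum fun l _ => (hcomp l).const_mul _
    have hsum : HasDerivAt (fun s => g s ⬝ᵥ A⁻¹ *ᵥ g s)
        ((A *ᵥ v t) ⬝ᵥ A⁻¹ *ᵥ g t + g t ⬝ᵥ A⁻¹ *ᵥ (A *ᵥ v t)) t := by
      simp only [dotProduct, ← Finset.sum_add_distrib]
      exact HasDerivAt.fun_sum fun k _ => (hcomp k).mul (hBg k)
    have hinv : A⁻¹ *ᵥ (A *ᵥ v t) = v t := by
      rw [mulVec_mulVec, nonsing_inv_mul _ hdet, one_mulVec]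
    convert hsum using 1
    rw [dotProduct_mulVec (A *ᵥ v t), ← mulVec_transpose, hsymm, hinv, dotProduct_comm (v t)]
    ring
  have hle : ∀ t, 0 ≤ t → 2 * (g t ⬝ᵥ v t) ≤
      -(w i₀ / (C + 1)) * (g t ⬝ᵥ A⁻¹ *ᵥ g t) + ∑ k, w k * f t k ^ 2 := by
    intro t _
    have h1 : 2 * (g t ⬝ᵥ v t) ≤ (∑ k, w k * f t k ^ 2) - w i₀ * ∑ k, g t k ^ 2 := by
      simp only [dotProduct, hv, Finset.mul_sum, ← Finset.sum_sub_distrib]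
      refine Finset.sum_le_sum fun k _ => ?_
      nlinarith [mul_nonneg (hw k).le (sq_nonneg (f t k - g t k)),
        mul_le_mul_of_nonneg_right (hi₀ k) (sq_nonneg (g t k)),
        mul_nonneg (hw k).le (sq_nonneg (f t k))]
    have hS : 0 ≤ ∑ k, g t k ^ 2 := Finset.sum_nonneg fun k _ => sq_nonneg _
    have h2 : g t ⬝ᵥ A⁻¹ *ᵥ g t ≤ (C + 1) * ∑ k, g t k ^ 2 :=
      (form_le_sum_abs_mul_sum_sq _ _).trans (by gcongr; linarith)
    have h3 : w i₀ / (C + 1) * (g t ⬝ᵥ A⁻¹ *ᵥ g t) ≤ w i₀ * ∑ k, g t k ^ 2 := by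
      rw [div_mul_eq_mul_div, div_le_iff₀ (by positivity)]
      nlinarith [mul_le_mul_of_nonneg_left h2 (hw i₀).le]
    linarith
  have hε : Tendsto (fun t => ∑ k, w k * f t k ^ 2) atTop (nhds 0) := by
    simpa using tendsto_finsetSum Finset.univ
      fun k _ => ((hf k).pow 2).const_mul (w k)
  rw [Metric.tendsto_nhds]
  intro δ hδ
  have hpos : 0 < A i i := hA.diag_pos
  filter_upwards [eventually_lt_of_deriv_le_neg_mul_add (div_pos (hw i₀) (by positivity)) hW hle hε
    (show 0 < δ ^ 2 / A i i by positivity)] with t ht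
  rw [lt_div_iff₀ hpos] at ht
  rw [Real.dist_eq, sub_zero]
  refine abs_lt_of_sq_lt_sq ?_ hδ.le
  linarith [hA.sq_le_diag_mul_inv_form (g t) i]

/-- A supremum over a finite nonempty index type of convergent real functions converges. -/
theorem Filter.Tendsto.ciSup_of_finite {ι α : Type*} [Finite ι] [Nonempty ι] {l : Filter α}
    {f : ι → α → ℝ} {b : ι → ℝ} (hf : ∀ i, Tendsto (f i) l (nhds (b i))) :
    Tendsto (fun t => ⨆ i, f i t) l (nhds (⨆ i, b i)) := by
  have := Fintype.ofFinite ι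
  simp only [← Finset.sup'_univ_eq_ciSup]
  exact Tendsto.finset_sup'_nhds_apply _ fun i _ => hf i

/-- Convergence of the finite-horizon limit ODE to the Bellman solution: any
solution `h` of the finite-horizon limit ODE (with terminal level
`h_t(J,x,a) = r(J,x)`) satisfies `sup_{j,x,a} |h_t(j,x,a) − V(j,x,a)| → 0` as
`t → ∞`, where `V` is the (unique) solution of the finite-horizon Bellman
equation. -/
theorem stmt_16
    {𝒳 𝒜 : Type*} [Fintype 𝒳] [Fintype 𝒜] [Nonempty 𝒳] [Nonempty 𝒜]
    [DecidableEq 𝒳] [DecidableEq 𝒜]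
    (J : ℕ) (hJ : 1 ≤ J)
    (r : ℕ → 𝒳 × 𝒜 → ℝ) (rT : 𝒳 → ℝ)
    (p : 𝒳 → 𝒳 × 𝒜 → ℝ)
    (hp_nonneg : ∀ z ζ, 0 ≤ p z ζ)
    (hp_sum : ∀ ζ, ∑ z : 𝒳, p z ζ = 1)
    (γ : ℝ) (hγ0 : 0 < γ) (hγ1 : γ ≤ 1)
    (π : ℕ → 𝒳 × 𝒜 → ℝ)
    (hπ_pos : ∀ j < J, ∀ ζ, 0 < π j ζ)
    (hπ_sum : ∀ j < J, ∑ ζ : 𝒳 × 𝒜, π j ζ = 1)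
    (A : Matrix (𝒳 × 𝒜) (𝒳 × 𝒜) ℝ) (hA : A.PosDef)
    (V : ℕ → 𝒳 × 𝒜 → ℝ)
    (hV_bellman : ∀ j < J, ∀ ζ : 𝒳 × 𝒜,
      V j ζ = r j ζ + γ * (∑ z : 𝒳, (⨆ a' : 𝒜, V (j + 1) (z, a')) * p z ζ))
    (hV_term : ∀ ζ : 𝒳 × 𝒜, V J ζ = rT ζ.1)
    (h : ℝ → ℕ → 𝒳 × 𝒜 → ℝ)
    (h_term : ∀ t : ℝ, ∀ ζ : 𝒳 × 𝒜, h t J ζ = rT ζ.1)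
    (hODE : ∀ j < J, ∀ ζ : 𝒳 × 𝒜, ∀ t : ℝ, 0 ≤ t →
      HasDerivAt (fun s => h s j ζ)
        (∑ ζ' : 𝒳 × 𝒜, π j ζ' * A ζ ζ' *
          (r j ζ' + γ * (∑ z : 𝒳, (⨆ a'' : 𝒜, h t (j + 1) (z, a'')) * p z ζ') -
            h t j ζ')) t) :
    Tendsto
      (fun t : ℝ => ⨆ j : Fin (J + 1), ⨆ ζ : 𝒳 × 𝒜, |h t (j : ℕ) ζ - V (j : ℕ) ζ|)
      atTop (nhds 0) := by
  have hconv : ∀ j ≤ J, ∀ ζ, Tendsto (fun t => h t j ζ) atTop (nhds (V j ζ)) := by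
    intro j hj
    induction hj using Nat.decreasingInduction with
    | self =>
      intro ζ
      simp only [h_term, hV_term]
      exact tendsto_const_nhds
    | of_succ j hj ih =>
      intro ζ
      have htarget : ∀ ζ', Tendsto (fun t => r j ζ' +
          γ * (∑ z : 𝒳, (⨆ a'' : 𝒜, h t (j + 1) (z, a'')) * p z ζ') - V j ζ') atTop (nhds 0) := by
        intro ζ'
        have hsum := tendsto_finsetSum Finset.univ fun z _ =>
          (Tendsto.ciSup_of_finite fun a : 𝒜 => ih (z, a)).mul_const (p z ζ')
        have := ((hsum.const_mul γ).const_add (r j ζ')).sub_const (V j ζ')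
        rwa [← hV_bellman j hj ζ', sub_self] at this
      have hzero := hA.tendsto_zero_of_hasDerivAt (hπ_pos j hj)
        (g := fun t ζ' => h t j ζ' - V j ζ')
        (fun ζ' t ht => by
          simp only [sub_sub_sub_cancel_right]
          exact (hODE j hj ζ' t ht).sub_const _)
        htarget ζ
      simpa using hzero.add_const (V j ζ)
  have hsup := Tendsto.ciSup_of_finite fun j : Fin (J + 1) => Tendsto.ciSup_of_finite fun ζ =>
    ((hconv j (Nat.lt_succ_iff.1 j.2) ζ).sub_const (V j ζ)).abs
  simpa using hsup
end
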